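/- arXiv:2003.02122 — 14 statements merged into one kernel-verified Lean document; each statement's English description precedes it below -/
import Mathlib

section
/- Let m, N be positive integers and for each i = 1, …, N let f_i : ℝ^m → ℝ be a bounded function for which there exist finitely many pairwise disjoint open convex subsets U_{i,1}, …, U_{i,k_i} of ℝ^m whose union is dense in ℝ^m and such that f_i is constant on each U_{i,j}. Define ℒ(θ) = (1/N) ∑_{i=1}^N f_i(θ). Then the interior of the set {θ ∈ ℝ^m : ℒ(θ) = essinf ℒ} is nonempty, where essinf is the essential infimum of ℒ over ℝ^m with respect to Lebesgue measure. -/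
open MeasureTheory

/-- the argmin set (interior of the essential-minimum level set) of an
empirical scale-free discrete loss is nonempty. -/
theorem stmt_0 (m N : ℕ) (hm : 0 < m) (hN : 0 < N)
    (f : Fin N → (Fin m → ℝ) → ℝ)
    (hbdd : ∀ i, ∃ C : ℝ, ∀ θ, |f i θ| ≤ C)
    (hdisc : ∀ i, ∃ (k : ℕ) (U : Fin k → Set (Fin m → ℝ)),
      (∀ j, IsOpen (U j)) ∧ (∀ j, Convex ℝ (U j)) ∧
      (Pairwise fun j j' => Disjoint (U j) (U j')) ∧
      Dense (⋃ j, U j) ∧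
      (∀ j, ∃ c : ℝ, ∀ θ ∈ U j, f i θ = c)) :
    (interior {θ : Fin m → ℝ |
      (1 / N : ℝ) * ∑ i, f i θ =
        essInf (fun θ' => (1 / N : ℝ) * ∑ i, f i θ')
          (volume : Measure (Fin m → ℝ))}).Nonempty := by
  classical
  choose k U hopen hconv _ hdense c hc using hdisc
  have hae : ∀ᵐ θ ∂(volume : Measure (Fin m → ℝ)), ∀ i, ∃ j, θ ∈ U i j := by
    rw [ae_all_iff]
    intro i
    have h1 : ∀ᵐ θ ∂(volume : Measure (Fin m → ℝ)), ∀ j, θ ∉ frontier (U i j) := by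
      rw [ae_all_iff]
      intro j
      exact measure_eq_zero_iff_ae_notMem.1 ((hconv i j).addHaar_frontier volume)
    filter_upwards [h1] with θ hθ
    have h2 : θ ∈ closure (⋃ j, U i j) := hdense i θ
    rw [closure_iUnion_of_finite] at h2
    obtain ⟨j, hj⟩ := Set.mem_iUnion.1 h2
    refine ⟨j, ?_⟩
    by_contra hn
    refine hθ j ⟨hj, ?_⟩
    rwa [(hopen i j).interior_eq]
  let V : (∀ i, Fin (k i)) → Set (Fin m → ℝ) := fun J => ⋂ i, U i (J i)
  have hV : ∀ J, IsOpen (V J) := fun J => isOpen_iInter_of_finite fun i => hopen i (J i)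
  let S : Finset (∀ i, Fin (k i)) := Finset.univ.filter fun J => (V J).Nonempty
  let F : (∀ i, Fin (k i)) → ℝ := fun J => (1 / N : ℝ) * ∑ i, c i (J i)
  have hF : ∀ J, ∀ θ ∈ V J, (1 / N : ℝ) * ∑ i, f i θ = F J := by
    intro J θ hθ
    have : ∑ i, f i θ = ∑ i, c i (J i) :=
      Finset.sum_congr rfl fun i _ => hc i (J i) θ (Set.mem_iInter.1 hθ i)
    simp only [F, this]
  have hS : S.Nonempty := by
    obtain ⟨θ, hθ⟩ := hae.exists
    choose J hJ using hθ
    exact ⟨J, Finset.mem_filter.2 ⟨Finset.mem_univ _, θ, Set.mem_iInter.2 hJ⟩⟩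
  obtain ⟨J, hJS, hJ⟩ := S.exists_min_image F hS
  have hne : (V J).Nonempty := (Finset.mem_filter.1 hJS).2
  have hess : essInf (fun θ' => (1 / N : ℝ) * ∑ i, f i θ')
      (volume : Measure (Fin m → ℝ)) = F J := by
    have hset : {a : ℝ | ∀ᶠ θ in ae (volume : Measure (Fin m → ℝ)),
        a ≤ (1 / N : ℝ) * ∑ i, f i θ} = Set.Iic (F J) := by
      ext a
      simp only [Set.mem_setOf_eq, Set.mem_Iic]
      constructor
      · intro ha
        by_contra hlt
        have h0 : volume (V J) = 0 := by
          refine measure_mono_null ?_ (ae_iff.1 ha)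
          intro θ hθ
          simp only [Set.mem_setOf_eq]
          rwa [hF J θ hθ]
        exact ((hV J).measure_pos volume hne).ne' h0
      · intro ha
        filter_upwards [hae] with θ hθ
        choose J' hJ' using hθ
        have hm' : θ ∈ V J' := Set.mem_iInter.2 hJ'
        rw [hF J' θ hm']
        exact ha.trans (hJ J' (Finset.mem_filter.2 ⟨Finset.mem_univ _, θ, hm'⟩))
    rw [essInf, Filter.liminf_eq, hset, csSup_Iic]
  rw [hess]
  exact hne.mono (interior_maximal (fun θ hθ => hF J θ hθ) (hV J))
end

section
/- Let n, m be positive integers, r ∈ ℝ^n, and let B = ⋃_{i≠j} {z ∈ ℝ^n : z_i = z_j}. Let L : ℝ^n → ℝ be a bounded measurable function such that: (i) L is constant on each connected component of ℝ^n \ B; (ii) for every z ∈ ℝ^n, limsup_{z'→z, z'∉B} L(z') = L(z); and (iii) for every z ∈ ℝ^n there exists ε₀ > 0 such that for every ε ∈ (0, ε₀] there exists δ > 0 such that L(z' − εr) = limsup_{z''→z, z''∉B} L(z'') for all z' with ‖z' − z‖ < δ. Let Φ : ℝ^m → ℝ^n be a linear map. Then for Lebesgue-almost every θ ∈ ℝ^m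 there exists δ > 0 such that for every ε' > 0 there exist μ > 0 and σ₀ > 0 such that for all σ ∈ (0, σ₀) and all θ' with ‖θ' − θ‖ < δ: |∫_{ℝ^n} L(Φθ' − σμr + σε) dγ_n(ε) − L(Φθ')| < ε', where γ_n is the standard Gaussian measure on ℝ^n. -/
open MeasureTheory Filter ProbabilityTheory

/-- Points with the same strict order pattern. -/
def SamePat {n : ℕ} (z z' : Fin n → ℝ) : Prop := ∀ i j, z i < z j ↔ z' i < z' j

lemma mem_compl_B {n : ℕ} (B : Set (Fin n → ℝ))
    (hB : B = ⋃ (i : Fin n) (j : Fin n) (_ : i ≠ j), {z : Fin n → ℝ | z i = z j})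
    (z : Fin n → ℝ) : z ∈ Bᶜ ↔ ∀ i j, i ≠ j → z i ≠ z j := by
  subst hB; simp

lemma SamePat.eq_iff {n : ℕ} {z z' : Fin n → ℝ} (h : SamePat z z') (i j : Fin n) :
    z i = z j ↔ z' i = z' j := by
  have h1 := h i j
  have h2 := h j i
  constructor
  · intro e
    rw [e] at h1 h2
    simp only [lt_irrefl, false_iff, not_lt] at h1 h2
    linarith
  · intro e
    rw [e] at h1 h2
    simp only [lt_irrefl, iff_false, not_lt] at h1 h2
    linarith

lemma chamber_const {n : ℕ} (B : Set (Fin n → ℝ))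
    (hB : B = ⋃ (i : Fin n) (j : Fin n) (_ : i ≠ j), {z : Fin n → ℝ | z i = z j})
    (L : (Fin n → ℝ) → ℝ)
    (hconst : ∀ z ∉ B, ∀ z' ∈ connectedComponentIn Bᶜ z, L z' = L z)
    (z z' : Fin n → ℝ) (hz : z ∈ Bᶜ) (h : SamePat z z') : L z' = L z := by
  apply hconst z hz
  have hseg : segment ℝ z z' ⊆ Bᶜ := by
    rintro x ⟨a, b, ha, hb, hab, rfl⟩
    rw [mem_compl_B B hB] at hz ⊢
    intro i j hij
    simp only [Pi.add_apply, Pi.smul_apply, smul_eq_mul]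
    have key : ∀ i j, z i < z j → a * z i + b * z' i < a * z j + b * z' j := by
      intro i j hlt
      have hlt' := (h i j).1 hlt
      rcases ha.eq_or_lt with h0 | h0
      · have : b = 1 := by linarith
        subst this; rw [← h0]; linarith
      · have := mul_lt_mul_of_pos_left hlt h0
        have := mul_le_mul_of_nonneg_left hlt'.le hb
        linarith
    rcases lt_or_gt_of_ne (hz i j hij) with h1 | h1
    · exact (key i j h1).ne
    · exact (key j i h1).ne'
  exact (convex_segment z z').isPreconnected.subset_connectedComponentIn
    (left_mem_segment ℝ z z') hseg (right_mem_segment ℝ z z')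

lemma order_nhds {n : ℕ} (z : Fin n → ℝ) :
    ∀ᶠ x in nhds z, ∀ i j, z i < z j → x i < x j := by
  rw [eventually_all]; intro i
  rw [eventually_all]; intro j
  by_cases h : z i < z j
  · have : IsOpen {x : Fin n → ℝ | x i < x j} :=
      isOpen_lt (continuous_apply i) (continuous_apply j)
    filter_upwards [this.mem_nhds h] with x hx _ using hx
  · exact Eventually.of_forall fun x hx => absurd hx h

lemma pat_const {n : ℕ} (B : Set (Fin n → ℝ))
    (hB : B = ⋃ (i : Fin n) (j : Fin n) (_ : i ≠ j), {z : Fin n → ℝ | z i = z j})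
    (L : (Fin n → ℝ) → ℝ)
    (hconst : ∀ z ∉ B, ∀ z' ∈ connectedComponentIn Bᶜ z, L z' = L z)
    (husc : ∀ z : Fin n → ℝ, Filter.limsup L (nhdsWithin z Bᶜ) = L z)
    (z z' : Fin n → ℝ) (h : SamePat z z') : L z' = L z := by
  set d := z' - z with hd
  have hzd : z + d = z' := by simp [hd]
  have hT : Tendsto (fun x : Fin n → ℝ => x + d) (nhds z) (nhds z') := by
    rw [← hzd]; exact (continuous_id.add continuous_const).tendsto z
  have hev : ∀ᶠ x in nhds z, SamePat x (x + d) := by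
    filter_upwards [order_nhds z, hT.eventually (order_nhds z')] with x h1 h2 i j
    rcases lt_trichotomy (z i) (z j) with hl | he | hg
    · exact ⟨fun _ => h2 i j ((h i j).1 hl), fun _ => h1 i j hl⟩
    · have he' := (h.eq_iff i j).1 he
      simp only [Pi.add_apply, hd, Pi.sub_apply, he, he']
      constructor <;> intro <;> linarith
    · have a1 := h1 j i hg
      have a2 := h2 j i ((h j i).1 hg)
      exact ⟨fun q => absurd q a1.not_gt, fun q => absurd q a2.not_gt⟩
  have hmap : map (fun x : Fin n → ℝ => x + d) (nhdsWithin z Bᶜ) = nhdsWithin z' Bᶜ := by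
    have e1 : nhdsWithin z Bᶜ = nhdsWithin z ((fun x => x + d) ⁻¹' Bᶜ) := by
      rw [nhdsWithin_eq_iff_eventuallyEq]
      filter_upwards [hev] with x hx
      apply propext
      change x ∈ Bᶜ ↔ (x + d) ∈ Bᶜ
      rw [mem_compl_B B hB, mem_compl_B B hB]
      simp only [ne_eq, hx.eq_iff]
    rw [e1]
    have := (Homeomorph.addRight d).isInducing.map_nhdsWithin_eq ((fun x => x + d) ⁻¹' Bᶜ) z
    simp only [Homeomorph.coe_addRight] at this
    rw [this, Set.image_preimage_eq _ (add_right_surjective d), hzd]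
  rw [← husc z', ← husc z, ← hmap]
  have hcomp : limsup L (map (fun x : Fin n → ℝ => x + d) (nhdsWithin z Bᶜ))
      = limsup (fun x => L (x + d)) (nhdsWithin z Bᶜ) := by
    simp only [limsup, Filter.map_map, Function.comp_def]
  rw [hcomp]
  apply limsup_congr
  filter_upwards [nhdsWithin_le_nhds hev, self_mem_nhdsWithin] with x hx hxB
  exact chamber_const B hB L hconst x (x + d) hxB hx

lemma ae_tied {n m : ℕ} (Φ : (Fin m → ℝ) →ₗ[ℝ] (Fin n → ℝ)) :
    ∀ᵐ θ ∂(volume : Measure (Fin m → ℝ)), ∀ i j, Φ θ i = Φ θ j → ∀ θ', Φ θ' i = Φ θ' j := by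
  rw [ae_all_iff]; intro i
  rw [ae_all_iff]; intro j
  set f : (Fin m → ℝ) →ₗ[ℝ] ℝ :=
    ((LinearMap.proj i : (Fin n → ℝ) →ₗ[ℝ] ℝ) - (LinearMap.proj j : (Fin n → ℝ) →ₗ[ℝ] ℝ)) ∘ₗ Φ with hf
  have hfx : ∀ θ, f θ = Φ θ i - Φ θ j := fun θ => by simp [hf]
  by_cases ht : LinearMap.ker f = ⊤
  · refine Eventually.of_forall fun θ _ θ' => ?_
    have : θ' ∈ LinearMap.ker f := ht ▸ Submodule.mem_top
    rw [LinearMap.mem_ker, hfx] at this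
    linarith
  · have h0 := Measure.addHaar_submodule (volume : Measure (Fin m → ℝ)) _ ht
    have : ∀ᵐ θ ∂(volume : Measure (Fin m → ℝ)), θ ∉ (LinearMap.ker f : Set (Fin m → ℝ)) :=
      measure_eq_zero_iff_ae_notMem.1 h0
    filter_upwards [this] with θ hθ he
    exfalso; apply hθ
    simp [LinearMap.mem_ker, hfx, he]

lemma tail_small {n : ℕ} (P : Measure (Fin n → ℝ)) [IsProbabilityMeasure P] (c : ℝ)
    (hc : 0 < c) : ∃ R > (0 : ℝ), P.real {e | R ≤ ‖e‖} < c := by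
  have h1 : Tendsto (fun k : ℕ => P {e : Fin n → ℝ | (k : ℝ) ≤ ‖e‖}) atTop
      (nhds (P (⋂ k : ℕ, {e : Fin n → ℝ | (k : ℝ) ≤ ‖e‖}))) := by
    apply tendsto_measure_iInter_atTop
    · intro k
      exact (measurableSet_le measurable_const measurable_norm).nullMeasurableSet
    · intro a b hab e he
      simp only [Set.mem_ofPred_eq] at he ⊢
      exact le_trans (Nat.cast_le.2 hab) he
    · exact ⟨0, measure_ne_top _ _⟩
  have h2 : (⋂ k : ℕ, {e : Fin n → ℝ | (k : ℝ) ≤ ‖e‖}) = ∅ := by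
    ext e
    simp only [Set.mem_iInter, Set.mem_ofPred_eq, Set.mem_empty_iff_false, iff_false, not_forall,
      not_le]
    exact exists_nat_gt _
  rw [h2, measure_empty] at h1
  have h3 := (h1.eventually (gt_mem_nhds (ENNReal.ofReal_pos.2 hc))).and (eventually_gt_atTop 0)
  obtain ⟨k, hk, hk0⟩ := h3.exists
  refine ⟨k, by exact_mod_cast hk0, ?_⟩
  rw [Measure.real]
  exact (ENNReal.lt_ofReal_iff_toReal_lt (measure_ne_top _ _)).1 hk

lemma integral_close {n : ℕ} (P : Measure (Fin n → ℝ)) [IsProbabilityMeasure P]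
    (f : (Fin n → ℝ) → ℝ) (hf : Measurable f) (l c R : ℝ) (hl : ∀ e, |f e| ≤ l)
    (hcl : |c| ≤ l) (h : ∀ e, ‖e‖ < R → f e = c) :
    |(∫ e, f e ∂P) - c| ≤ 2 * l * P.real {e | R ≤ ‖e‖} := by
  have hfi : Integrable f P :=
    Integrable.of_bound hf.aestronglyMeasurable l (Eventually.of_forall hl)
  have hm : MeasurableSet {e : Fin n → ℝ | R ≤ ‖e‖} :=
    measurableSet_le measurable_const measurable_norm
  have e1 : (∫ e, f e ∂P) - c = ∫ e, (f e - c) ∂P := by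
    rw [integral_sub hfi (integrable_const c)]; simp
  have e2 : ∫ e, ({e : Fin n → ℝ | R ≤ ‖e‖}).indicator (fun _ => 2 * l) e ∂P
      = 2 * l * P.real {e | R ≤ ‖e‖} := by
    rw [integral_indicator_const _ hm, smul_eq_mul, mul_comm]
  rw [e1, ← e2, ← Real.norm_eq_abs]
  have hgi : Integrable (({e : Fin n → ℝ | R ≤ ‖e‖}).indicator (fun _ => 2 * l)) P :=
    (integrable_const (2 * l)).indicator hm
  refine norm_integral_le_of_norm_le hgi (Eventually.of_forall fun e => ?_)
  by_cases he : R ≤ ‖e‖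
  · rw [Set.indicator_of_mem (by exact he)]
    rw [Real.norm_eq_abs]
    have := abs_sub (f e) c
    linarith [hl e]
  · rw [Set.indicator_of_notMem (by exact he), h e (not_le.1 he)]; simp

/-- Theorem 1 of the paper: the shifted Gaussian family N(−μr, I_n) is a
consistent smoothing for ranking loss functions. -/
theorem stmt_1 (n m : ℕ) (hn : 0 < n) (hm : 0 < m) (r : Fin n → ℝ)
    (B : Set (Fin n → ℝ))
    (hB : B = ⋃ (i : Fin n) (j : Fin n) (_ : i ≠ j), {z : Fin n → ℝ | z i = z j})
    (L : (Fin n → ℝ) → ℝ) (hLmeas : Measurable L) (l : ℝ) (hLbdd : ∀ z, |L z| ≤ l)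
    (hconst : ∀ z ∉ B, ∀ z' ∈ connectedComponentIn Bᶜ z, L z' = L z)
    (husc : ∀ z : Fin n → ℝ, Filter.limsup L (nhdsWithin z Bᶜ) = L z)
    (hmono : ∀ z : Fin n → ℝ, ∃ ε₀ > (0 : ℝ), ∀ ε ∈ Set.Ioc (0 : ℝ) ε₀, ∃ δ > (0 : ℝ),
      ∀ z' : Fin n → ℝ, ‖z' - z‖ < δ →
        L (z' - ε • r) = Filter.limsup L (nhdsWithin z Bᶜ))
    (Φ : (Fin m → ℝ) →ₗ[ℝ] (Fin n → ℝ)) :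
    ∀ᵐ θ ∂(volume : Measure (Fin m → ℝ)), ∃ δ > (0 : ℝ), ∀ ε' > (0 : ℝ),
      ∃ μ > (0 : ℝ), ∃ σ₀ > (0 : ℝ), ∀ σ ∈ Set.Ioo (0 : ℝ) σ₀,
        ∀ θ' : Fin m → ℝ, ‖θ' - θ‖ < δ →
          |(∫ ε, L (Φ θ' - (σ * μ) • r + σ • ε)
              ∂(Measure.pi fun _ : Fin n => gaussianReal 0 1)) - L (Φ θ')| < ε' := by
  filter_upwards [ae_tied Φ] with θ hθ
  obtain ⟨ρ, hρ, hG⟩ := Metric.eventually_nhds_iff.1 (order_nhds (Φ θ))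
  simp only [dist_eq_norm] at hG
  have hc : ContinuousAt Φ θ := (LinearMap.continuous_of_finiteDimensional Φ).continuousAt
  obtain ⟨δ, hδ, hΦ⟩ := Metric.continuousAt_iff.1 hc (ρ / 2) (by positivity)
  simp only [dist_eq_norm] at hΦ
  -- pattern comparison
  have pat : ∀ x y : Fin n → ℝ, ‖x - Φ θ‖ < ρ → ‖y - Φ θ‖ < ρ →
      (∀ i j, Φ θ i = Φ θ j → (x i < x j ↔ y i < y j)) → L y = L x := by
    intro x y hx hy ht
    apply pat_const B hB L hconst husc
    intro i j
    rcases lt_trichotomy (Φ θ i) (Φ θ j) with hl | he | hg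
    · exact ⟨fun _ => hG hy i j hl, fun _ => hG hx i j hl⟩
    · exact ht i j he
    · exact ⟨fun q => absurd q (hG hx j i hg).not_gt, fun q => absurd q (hG hy j i hg).not_gt⟩
  obtain ⟨ε₀, hε₀, hmo⟩ := hmono (Φ θ)
  rw [husc] at hmo
  have hr1 : 0 < ‖r‖ + 1 := by positivity
  set ε := min ε₀ (ρ / 4 / (‖r‖ + 1)) with hε
  have hεpos : 0 < ε := lt_min hε₀ (by positivity)
  have hεr : ε * ‖r‖ ≤ ρ / 4 := by
    have : ε * (‖r‖ + 1) ≤ ρ / 4 := (le_div_iff₀ hr1).1 (min_le_right _ _)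
    linarith
  obtain ⟨δ₀, hδ₀, hmo⟩ := hmo ε ⟨hεpos, min_le_left _ _⟩
  set δ₁ := min δ₀ (ρ / 4) with hδ₁
  have hδ₁pos : 0 < δ₁ := lt_min hδ₀ (by positivity)
  refine ⟨δ, hδ, fun ε' hε' => ?_⟩
  have hl0 : 0 ≤ l := (abs_nonneg _).trans (hLbdd 0)
  obtain ⟨R, hR, hRt⟩ := tail_small (Measure.pi fun _ : Fin n => gaussianReal 0 1)
    (ε' / (2 * l + 1)) (by positivity)
  set μ := R * ε / δ₁ with hμ
  have hμpos : 0 < μ := by positivity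
  refine ⟨μ, hμpos, ε / μ, by positivity, fun σ hσ θ' hθ' => ?_⟩
  have hz' := hΦ hθ'
  have hLz' : L (Φ θ') = L (Φ θ) := by
    apply pat _ _ (by simpa using hρ) (by linarith)
    intro i j hij
    simp [hij, hθ i j hij θ']
  have hsε : σ * μ < ε := (lt_div_iff₀ hμpos).1 hσ.2
  have hs0 : 0 < σ * μ := mul_pos hσ.1 hμpos
  refine lt_of_le_of_lt (integral_close _ _ ?_ l _ R (fun e => hLbdd _) (hLbdd _) ?_) ?_
  · fun_prop
  · intro e he
    rw [hLz']
    have hbound : (ε / μ) * ‖e‖ < δ₁ := by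
      have h1 : (ε / μ) * ‖e‖ < (ε / μ) * R := by gcongr
      have h2 : (ε / μ) * R = δ₁ := by rw [hμ]; field_simp
      linarith
    have hw := hmo (Φ θ + (ε / μ) • e) (by
      rw [add_sub_cancel_left, norm_smul, Real.norm_of_nonneg (by positivity)]
      exact hbound.trans_le (min_le_left _ _))
    rw [← hw]
    have hδρ : δ₁ ≤ ρ / 4 := min_le_right _ _
    apply pat
    · have e1 : Φ θ + (ε / μ) • e - ε • r - Φ θ = (ε / μ) • e - ε • r := by abel
      rw [e1]
      have := norm_sub_le ((ε / μ) • e) (ε • r)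
      rw [norm_smul, norm_smul, Real.norm_of_nonneg (by positivity : 0 ≤ ε / μ),
        Real.norm_of_nonneg hεpos.le] at this
      linarith
    · have e1 : Φ θ' - (σ * μ) • r + σ • e - Φ θ = (Φ θ' - Φ θ) + (σ • e - (σ * μ) • r) := by abel
      rw [e1]
      have h1 := norm_add_le (Φ θ' - Φ θ) (σ • e - (σ * μ) • r)
      have h2 := norm_sub_le (σ • e) ((σ * μ) • r)
      rw [norm_smul, norm_smul, Real.norm_of_nonneg hσ.1.le, Real.norm_of_nonneg hs0.le] at h2
      have h3 : σ * ‖e‖ ≤ (ε / μ) * ‖e‖ := mul_le_mul_of_nonneg_right hσ.2.le (norm_nonneg _)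
      have h4 : (σ * μ) * ‖r‖ ≤ ε * ‖r‖ := mul_le_mul_of_nonneg_right hsε.le (norm_nonneg _)
      linarith
    · intro i j hij
      have hij' := hθ i j hij θ'
      simp only [Pi.add_apply, Pi.sub_apply, Pi.smul_apply, smul_eq_mul, hij, hij']
      have k1 : (Φ θ j + ε / μ * e j - ε * r j) - (Φ θ j + ε / μ * e i - ε * r i)
          = (ε / μ) * ((e j - μ * r j) - (e i - μ * r i)) := by field_simp; ring
      have k2 : (Φ θ' j - σ * μ * r j + σ * e j) - (Φ θ' j - σ * μ * r i + σ * e i)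
          = σ * ((e j - μ * r j) - (e i - μ * r i)) := by ring
      rw [← sub_pos, k1, ← sub_pos (b := Φ θ' j - σ * μ * r i + σ * e i), k2,
        mul_pos_iff_of_pos_left (by positivity), mul_pos_iff_of_pos_left hσ.1]
  · have h1 : (0 : ℝ) < 2 * l + 1 := by positivity
    have h2 := (lt_div_iff₀ h1).1 hRt
    have h3 : 0 ≤ (Measure.pi fun _ : Fin n => gaussianReal 0 1).real {e | R ≤ ‖e‖} :=
      measureReal_nonneg
    linarith
end

section
/- Let n be a positive integer, r ∈ ℝ^n, B = ⋃_{i≠j} {z ∈ ℝ^n : z_i = z_j}, and let L : ℝ^n → ℝ be a bounded measurable function satisfying: (i) L is constant on each connected component of ℝ^n \ B; (ii) for every z ∈ ℝ^n, limsup_{z'→z, z'∉B} L(z') = L(z); and (iii) for every z ∈ ℝ^n there exists ε₀ > 0 such that for every ε ∈ (0, ε₀] there exists δ > 0 such that L(z' − εr) = limsup_{z''→z, z''∉B} L(z'') for all z' with ‖z' − z‖ < δ. Then for every z ∈ ℝ^n, lim_{μ→∞} limsup_{σ→0⁺} |∫_{ℝ^n} L(z − σμr + σε) dγ_n(ε)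 − L(z)| = 0, where γ_n is the standard Gaussian measure on ℝ^n. -/
open MeasureTheory Filter ProbabilityTheory

/-- The complement of the braid arrangement accumulates at every point. -/
lemma aux_neBot (n : ℕ) (B : Set (Fin n → ℝ))
    (hB : ∀ z, z ∉ B ↔ ∀ i j : Fin n, i ≠ j → z i ≠ z j) (p : Fin n → ℝ) :
    (nhdsWithin p Bᶜ).NeBot := by
  have h : Tendsto (fun s : ℝ => p + s • (fun i : Fin n => ((i : ℕ) : ℝ)))
      (nhdsWithin 0 (Set.Ioi 0)) (nhdsWithin p Bᶜ) := by
    apply tendsto_nhdsWithin_iff.2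
    constructor
    · have hc : Continuous (fun s : ℝ => p + s • (fun i : Fin n => ((i : ℕ) : ℝ))) := by fun_prop
      have := (hc.tendsto 0).mono_left (nhdsWithin_le_nhds (s := Set.Ioi 0))
      simpa using this
    · have : ∀ i j : Fin n, ∀ᶠ s : ℝ in nhdsWithin 0 (Set.Ioi 0), i ≠ j →
          p i + s * ((i : ℕ) : ℝ) ≠ p j + s * ((j : ℕ) : ℝ) := by
        intro i j
        by_cases hp : p i = p j
        · filter_upwards [self_mem_nhdsWithin] with s hs hij h
          have hs : 0 < s := hs
          rw [hp] at h
          have h2 := mul_left_cancel₀ hs.ne' (add_left_cancel h)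
          exact hij (Fin.ext (by exact_mod_cast h2))
        · have hc : Continuous (fun s : ℝ => (p i + s * ((i : ℕ) : ℝ)) - (p j + s * ((j : ℕ) : ℝ))) := by
            fun_prop
          have h0 : (p i + (0:ℝ) * ((i : ℕ) : ℝ)) - (p j + 0 * ((j : ℕ) : ℝ)) ≠ 0 := by
            simpa [sub_eq_zero] using hp
          have := (hc.continuousAt (x := 0)).eventually_ne h0
          filter_upwards [nhdsWithin_le_nhds this] with s hs _ h
          exact hs (sub_eq_zero.2 h)
      have h2 := eventually_all.2 (fun i => eventually_all.2 (this i))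
      filter_upwards [h2] with s hs
      refine (hB _).2 (fun i j hij => ?_)
      simpa using hs i j hij
  exact h.neBot

/-- Near `z`, the complement of the arrangement is a cone with apex `z`. -/
lemma aux_radius (n : ℕ) (z : Fin n → ℝ) :
    ∃ ρ > (0:ℝ), ∀ w : Fin n → ℝ, ‖w‖ < ρ → ∀ i j : Fin n, z i ≠ z j → z i + w i ≠ z j + w j := by
  have : ∀ i j : Fin n, ∀ᶠ w : Fin n → ℝ in nhds 0, z i ≠ z j → z i + w i ≠ z j + w j := by
    intro i j
    by_cases hp : z i = z j
    · simp [hp]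
    · have hc : Continuous (fun w : Fin n → ℝ => (z i + w i) - (z j + w j)) := by fun_prop
      have := (hc.continuousAt (x := 0)).eventually_ne (y := 0) (by simpa [sub_eq_zero] using hp)
      filter_upwards [this] with w hw _ h
      exact hw (sub_eq_zero.2 h)
  have h2 := eventually_all.2 (fun i => eventually_all.2 (this i))
  obtain ⟨ρ, hρ, h⟩ := Metric.eventually_nhds_iff.1 h2
  exact ⟨ρ, hρ, fun w hw => h (by simpa using hw)⟩

/-- Homogeneity of `L` about `z` off the arrangement. -/
lemma aux_hom (n : ℕ) (B : Set (Fin n → ℝ))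
    (hB : ∀ z, z ∉ B ↔ ∀ i j : Fin n, i ≠ j → z i ≠ z j)
    (L : (Fin n → ℝ) → ℝ)
    (hconst : ∀ z ∉ B, ∀ z' ∈ connectedComponentIn Bᶜ z, L z' = L z)
    (z : Fin n → ℝ) (ρ : ℝ)
    (hρ : ∀ w : Fin n → ℝ, ‖w‖ < ρ → ∀ i j : Fin n, z i ≠ z j → z i + w i ≠ z j + w j)
    (w : Fin n → ℝ) (hw : ‖w‖ < ρ) (t : ℝ) (ht : t ∈ Set.Ioc (0:ℝ) 1) (htB : z + t • w ∉ B) :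
    L (z + t • w) = L (z + w) := by
  have key : ∀ s ∈ Set.Ioc (0:ℝ) 1, z + s • w ∉ B := by
    intro s hs
    refine (hB _).2 (fun i j hij => ?_)
    by_cases hz : z i = z j
    · have h1 := (hB _).1 htB i j hij
      simp only [Pi.add_apply, Pi.smul_apply, smul_eq_mul, hz] at h1 ⊢
      intro h
      apply h1
      rw [mul_left_cancel₀ hs.1.ne' (add_left_cancel h)]
    · apply hρ (s • w) _ i j hz
      rw [norm_smul, Real.norm_of_nonneg hs.1.le]
      exact (mul_le_of_le_one_left (norm_nonneg _) hs.2).trans_lt hw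
  have h1 : (1:ℝ) ∈ Set.Ioc (0:ℝ) 1 := by simp
  have hc : Continuous (fun s : ℝ => z + s • w) := by fun_prop
  have hpre : IsPreconnected ((fun s : ℝ => z + s • w) '' Set.Ioc (0:ℝ) 1) :=
    isPreconnected_Ioc.image _ hc.continuousOn
  have hw1 : z + w ∈ (fun s : ℝ => z + s • w) '' Set.Ioc (0:ℝ) 1 := ⟨1, h1, by simp⟩
  have hsub := hpre.subset_connectedComponentIn hw1 (F := Bᶜ) (by
    rintro _ ⟨s, hs, rfl⟩; exact key s hs)
  exact hconst _ (by simpa using key 1 h1) _ (hsub ⟨t, ht, rfl⟩)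

lemma aux_tail (n : ℕ) (P : Measure (Fin n → ℝ)) [IsProbabilityMeasure P] (c : ℝ) (hc : 0 < c) :
    Tendsto (fun μ : ℝ => P.real {x | c * μ ≤ ‖x‖}) atTop (nhds 0) := by
  have h : Tendsto (fun μ : ℝ => P {x | c * μ ≤ ‖x‖}) atTop
      (nhds (P (⋂ μ : ℝ, {x | c * μ ≤ ‖x‖}))) := by
    apply tendsto_measure_iInter_atTop
    · intro μ
      exact (measurableSet_le measurable_const measurable_norm).nullMeasurableSet
    · intro a b hab x hx
      have hx : c * b ≤ ‖x‖ := hx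
      exact le_trans (mul_le_mul_of_nonneg_left hab hc.le) hx
    · exact ⟨0, measure_ne_top _ _⟩
  have he : (⋂ μ : ℝ, {x : Fin n → ℝ | c * μ ≤ ‖x‖}) = ∅ := by
    ext x
    simp only [Set.mem_iInter, Set.mem_setOf_eq, Set.mem_empty_iff_false, iff_false, not_forall,
      not_le]
    refine ⟨(‖x‖ + 1) / c, ?_⟩
    rw [mul_div_cancel₀ _ hc.ne']
    linarith
  rw [he, measure_empty] at h
  have := (ENNReal.tendsto_toReal ENNReal.zero_ne_top).comp h
  simpa [Measure.real, Function.comp_def] using this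

lemma aux_int (n : ℕ) (P : Measure (Fin n → ℝ)) [IsProbabilityMeasure P]
    (f : (Fin n → ℝ) → ℝ) (hf : Measurable f) (l a : ℝ) (hl : ∀ x, |f x| ≤ l) (ha : |a| ≤ l)
    (R : ℝ) (h : ∀ x, ‖x‖ < R → f x = a) :
    |(∫ x, f x ∂P) - a| ≤ 2 * l * P.real {x | R ≤ ‖x‖} := by
  have hS : MeasurableSet {x : Fin n → ℝ | R ≤ ‖x‖} :=
    measurableSet_le measurable_const measurable_norm
  have hfi : Integrable f P := Integrable.of_bound hf.aestronglyMeasurable l (.of_forall hl)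
  have e : (∫ x, f x ∂P) - a = ∫ x, (f x - a) ∂P := by
    rw [integral_sub hfi (integrable_const _)]; simp
  have e2 : ∫ x, Set.indicator {x : Fin n → ℝ | R ≤ ‖x‖} (fun _ => 2 * l) x ∂P
      = 2 * l * P.real {x | R ≤ ‖x‖} := by
    rw [integral_indicator_const _ hS, smul_eq_mul, mul_comm]
  rw [e, ← e2, ← Real.norm_eq_abs]
  apply norm_integral_le_of_norm_le
  · exact (integrable_const _).indicator hS
  · refine .of_forall (fun x => ?_)
    by_cases hx : R ≤ ‖x‖
    · rw [Set.indicator_of_mem (by exact hx), Real.norm_eq_abs]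
      have := abs_sub (f x) a
      have := hl x
      linarith
    · rw [Set.indicator_of_notMem (by exact hx), h x (not_le.1 hx)]
      simp

/-- relevance monotonicity and strong upper semi-continuity imply the
pointwise consistency limit for shifted Gaussian smoothing:
lim_{μ→∞} limsup_{σ→0⁺} |E L(z − σμr + σε) − L(z)| = 0. -/
theorem stmt_2 (n : ℕ) (hn : 0 < n) (r : Fin n → ℝ)
    (B : Set (Fin n → ℝ))
    (hB : B = ⋃ (i : Fin n) (j : Fin n) (_ : i ≠ j), {z : Fin n → ℝ | z i = z j})
    (L : (Fin n → ℝ) → ℝ) (hLmeas : Measurable L) (l : ℝ) (hLbdd : ∀ z, |L z| ≤ l)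
    (hconst : ∀ z ∉ B, ∀ z' ∈ connectedComponentIn Bᶜ z, L z' = L z)
    (husc : ∀ z : Fin n → ℝ, Filter.limsup L (nhdsWithin z Bᶜ) = L z)
    (hmono : ∀ z : Fin n → ℝ, ∃ ε₀ > (0 : ℝ), ∀ ε ∈ Set.Ioc (0 : ℝ) ε₀, ∃ δ > (0 : ℝ),
      ∀ z' : Fin n → ℝ, ‖z' - z‖ < δ →
        L (z' - ε • r) = Filter.limsup L (nhdsWithin z Bᶜ)) :
    ∀ z : Fin n → ℝ,
      Tendsto (fun μ : ℝ =>
          Filter.limsup (fun σ : ℝ =>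
            |(∫ ε, L (z - (σ * μ) • r + σ • ε)
                ∂(Measure.pi fun _ : Fin n => gaussianReal 0 1)) - L z|)
            (nhdsWithin 0 (Set.Ioi 0)))
        atTop (nhds 0) := by
  have hBm : ∀ z, z ∉ B ↔ ∀ i j : Fin n, i ≠ j → z i ≠ z j := by
    intro z; rw [hB]; simp
  clear hB
  intro z
  obtain ⟨ρ, hρ0, hρ⟩ := aux_radius n z
  obtain ⟨ε₀, hε₀, hm⟩ := hmono z
  obtain ⟨ε₁, hε₁, hε₁', hε₁r⟩ : ∃ ε₁ > (0:ℝ), ε₁ ≤ ε₀ ∧ ε₁ * ‖r‖ < ρ / 2 := by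
    refine ⟨min ε₀ (ρ / 2 / (‖r‖ + 1)), by positivity, min_le_left _ _, ?_⟩
    have h1 : ρ / 2 / (‖r‖ + 1) * (‖r‖ + 1) = ρ / 2 := div_mul_cancel₀ _ (by positivity)
    have h2 : 0 < ρ / 2 / (‖r‖ + 1) := by positivity
    have := mul_le_mul_of_nonneg_right (min_le_right ε₀ (ρ / 2 / (‖r‖ + 1))) (norm_nonneg r)
    nlinarith
  obtain ⟨δ', hδ', hd⟩ := hm ε₁ ⟨hε₁, hε₁'⟩
  rw [husc z] at hd
  obtain ⟨δ, hδ, hδ1, hδ2⟩ : ∃ δ > (0:ℝ), δ ≤ δ' ∧ δ ≤ ρ / 2 :=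
    ⟨min δ' (ρ / 2), by positivity, min_le_left _ _, min_le_right _ _⟩
  -- constancy along the cone off the arrangement
  have coneOff : ∀ v : Fin n → ℝ, ‖v‖ < δ → ∀ t ∈ Set.Ioc (0:ℝ) 1,
      z + t • (v - ε₁ • r) ∉ B → L (z + t • (v - ε₁ • r)) = L z := by
    intro v hv t ht hB
    have hw : ‖v - ε₁ • r‖ < ρ := by
      have := norm_sub_le v (ε₁ • r)
      rw [norm_smul, Real.norm_of_nonneg hε₁.le] at this
      linarith
    rw [aux_hom n B hBm L hconst z ρ hρ _ hw t ht hB]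
    have := hd (z + v) (by simpa using hv.trans_le hδ1)
    rw [← this]; congr 1; abel
  have cone : ∀ v : Fin n → ℝ, ‖v‖ < δ → ∀ t ∈ Set.Ioc (0:ℝ) 1,
      L (z + t • (v - ε₁ • r)) = L z := by
    intro v hv t ht
    have hne := aux_neBot n B hBm (z + t • (v - ε₁ • r))
    rw [← husc (z + t • (v - ε₁ • r))]
    have hev : L =ᶠ[nhdsWithin (z + t • (v - ε₁ • r)) Bᶜ] fun _ => L z := by
      have hc : Continuous (fun y : Fin n → ℝ => ‖t⁻¹ • (y - z) + ε₁ • r‖) := by fun_prop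
      have hlt : ∀ᶠ y in nhds (z + t • (v - ε₁ • r)), ‖t⁻¹ • (y - z) + ε₁ • r‖ < δ := by
        apply hc.continuousAt.eventually_lt_const
        simpa [smul_smul, inv_mul_cancel₀ ht.1.ne'] using hv
      filter_upwards [nhdsWithin_le_nhds hlt, self_mem_nhdsWithin] with y hy hyB
      have e : z + t • ((t⁻¹ • (y - z) + ε₁ • r) - ε₁ • r) = y := by
        simp [smul_smul, mul_inv_cancel₀ ht.1.ne']
      have := coneOff _ hy t ht (by rw [e]; exact hyB)
      rwa [e] at this
    rw [limsup_congr hev, limsup_const]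
  set P : Measure (Fin n → ℝ) := Measure.pi fun _ : Fin n => gaussianReal 0 1 with hP
  have bound : ∀ μ > (0:ℝ), ∀ᶠ σ : ℝ in nhdsWithin 0 (Set.Ioi 0),
      |(∫ ε, L (z - (σ * μ) • r + σ • ε) ∂P) - L z|
        ≤ 2 * l * P.real {x | δ / ε₁ * μ ≤ ‖x‖} := by
    intro μ hμ
    have : Set.Ioc (0:ℝ) (ε₁ / μ) ∈ nhdsWithin (0:ℝ) (Set.Ioi 0) :=
      Ioc_mem_nhdsGT (by positivity)
    filter_upwards [this] with σ hσ
    have hσ0 := hσ.1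
    apply aux_int n P (fun ε => L (z - (σ * μ) • r + σ • ε)) _ l (L z) (fun _ => hLbdd _) (hLbdd z)
    · intro x hx
      have ht : σ * μ / ε₁ ∈ Set.Ioc (0:ℝ) 1 := by
        refine ⟨by positivity, ?_⟩
        rw [div_le_one hε₁]
        exact (le_div_iff₀ hμ).1 hσ.2
      have := cone ((ε₁ / μ) • x) (by
        rw [norm_smul, Real.norm_of_nonneg (by positivity)]
        calc ε₁ / μ * ‖x‖ < ε₁ / μ * (δ / ε₁ * μ) := by gcongr
          _ = δ := by field_simp) _ ht
      rw [← this]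
      congr 1
      ext i
      simp only [Pi.add_apply, Pi.sub_apply, Pi.smul_apply, smul_eq_mul]
      field_simp
      ring
    · apply hLmeas.comp
      fun_prop
  have hlim : Tendsto (fun μ : ℝ => 2 * l * P.real {x | δ / ε₁ * μ ≤ ‖x‖}) atTop (nhds 0) := by
    simpa using (aux_tail n P (δ / ε₁) (by positivity)).const_mul (2 * l)
  refine tendsto_of_tendsto_of_tendsto_of_le_of_le' tendsto_const_nhds hlim ?_ ?_
  · filter_upwards [eventually_gt_atTop 0] with μ hμ
    refine le_limsup_of_frequently_le (Eventually.of_forall fun σ => abs_nonneg _).frequently ?_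
    exact ⟨_, eventually_map.2 (bound μ hμ)⟩
  · filter_upwards [eventually_gt_atTop 0] with μ hμ
    refine limsup_le_of_le ?_ (bound μ hμ)
    exact isCoboundedUnder_le_of_le _ (fun σ => abs_nonneg _)
end

section
/- Let n, m be positive integers, Φ : ℝ^m → ℝ^n a linear map with image V = im Φ, and L : ℝ^n → ℝ a bounded measurable function. Suppose there exist open convex subsets U_1, …, U_k of ℝ^n such that L is constant on each U_j and the closure of ⋃_j (U_j ∩ V) equals V. Then for every probability density π on ℝ^n and for Lebesgue-almost every θ ∈ ℝ^m: lim_{σ→0⁺} ∫_{ℝ^n} L(Φθ + σε) π(ε) dε = L(Φθ). -/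
open MeasureTheory Filter

/-- Theorem 2 of the paper: if the image of the linear model meets the open
convex sets on which the discrete loss is locally constant in a relatively dense way, then
any stochastic smoothing is consistent for almost every parameter vector. -/
theorem stmt_3 (n m : ℕ) (hn : 0 < n) (hm : 0 < m)
    (Φ : (Fin m → ℝ) →ₗ[ℝ] (Fin n → ℝ))
    (L : (Fin n → ℝ) → ℝ) (hLmeas : Measurable L) (l : ℝ) (hLbdd : ∀ z, |L z| ≤ l)
    (k : ℕ) (U : Fin k → Set (Fin n → ℝ))
    (hopen : ∀ j, IsOpen (U j)) (hconv : ∀ j, Convex ℝ (U j))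
    (hconst : ∀ j, ∃ c : ℝ, ∀ z ∈ U j, L z = c)
    (hdense : closure (⋃ j, U j ∩ Set.range Φ) = Set.range Φ)
    (π : (Fin n → ℝ) → ℝ) (hπmeas : Measurable π) (hπnn : ∀ ε, 0 ≤ π ε)
    (hπint : ∫ ε, π ε = 1) :
    ∀ᵐ θ ∂(volume : Measure (Fin m → ℝ)),
      Tendsto (fun σ : ℝ => ∫ ε, L (Φ θ + σ • ε) * π ε)
        (nhdsWithin 0 (Set.Ioi 0)) (nhds (L (Φ θ))) := by
  have hΦc : Continuous Φ := Φ.continuous_of_finiteDimensional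
  have hnull : ∀ᵐ θ ∂(volume : Measure (Fin m → ℝ)), ∀ j, θ ∉ frontier (Φ ⁻¹' (U j)) := by
    rw [ae_all_iff]
    intro j
    have h0 := ((hconv j).linear_preimage Φ).addHaar_frontier (volume : Measure (Fin m → ℝ))
    exact measure_eq_zero_iff_ae_notMem.1 h0
  filter_upwards [hnull] with θ hθ
  -- `Φ θ` lies in one of the sets
  obtain ⟨j, hj⟩ : ∃ j, Φ θ ∈ U j := by
    have h1 : Φ θ ∈ closure (⋃ j, U j ∩ Set.range Φ) := by
      rw [hdense]; exact ⟨θ, rfl⟩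
    rw [closure_iUnion_of_finite] at h1
    obtain ⟨j, hj⟩ := Set.mem_iUnion.1 h1
    refine ⟨j, ?_⟩
    have hopenmap : IsOpenMap Φ.rangeRestrict :=
      Φ.rangeRestrict.isOpenMap_of_finiteDimensional Φ.surjective_rangeRestrict
    have h2 : Φ.rangeRestrict θ ∈
        closure ((Subtype.val : LinearMap.range Φ → (Fin n → ℝ)) ⁻¹' (U j)) := by
      rw [closure_subtype, Set.image_preimage_eq_inter_range]
      have : Set.range (Subtype.val : LinearMap.range Φ → (Fin n → ℝ)) = Set.range Φ := by
        ext x; simp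
      rw [this]
      exact hj
    have h3 : θ ∈ closure (Φ ⁻¹' (U j)) :=
      hopenmap.preimage_closure_subset_closure_preimage h2
    by_contra hn'
    apply hθ j
    rw [((hopen j).preimage hΦc).frontier_eq]
    exact ⟨h3, hn'⟩
  obtain ⟨c, hc⟩ := hconst j
  have hπi : Integrable π := by
    by_contra h
    rw [integral_undef h] at hπint
    exact zero_ne_one hπint
  have hlim : L (Φ θ) = ∫ ε, L (Φ θ) * π ε := by
    rw [integral_const_mul, hπint, mul_one]
  rw [hlim]
  refine tendsto_integral_filter_of_dominated_convergence (fun ε => l * π ε) ?_ ?_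
    (hπi.const_mul l) ?_
  · refine Eventually.of_forall fun σ => ?_
    have : Measurable fun ε : Fin n → ℝ => Φ θ + σ • ε := by fun_prop
    exact ((hLmeas.comp this).mul hπmeas).aestronglyMeasurable
  · refine Eventually.of_forall fun σ => Eventually.of_forall fun ε => ?_
    rw [Real.norm_eq_abs, abs_mul, abs_of_nonneg (hπnn ε)]
    exact mul_le_mul_of_nonneg_right (hLbdd _) (hπnn ε)
  · refine Eventually.of_forall fun ε => ?_
    have ht : Tendsto (fun σ : ℝ => Φ θ + σ • ε) (nhdsWithin 0 (Set.Ioi 0)) (nhds (Φ θ)) := by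
      have : Continuous (fun σ : ℝ => Φ θ + σ • ε) := by fun_prop
      have h := this.tendsto 0
      simp only [zero_smul, add_zero] at h
      exact h.mono_left nhdsWithin_le_nhds
    refine tendsto_const_nhds.congr' ?_
    filter_upwards [ht.eventually ((hopen j).mem_nhds hj)] with σ hσ
    rw [hc _ hσ, hc _ hj]
end

section
/- Let n ≥ 2, σ > 0, j ∈ {1, …, n}, and let π(ε) = ∏_{i=1}^n π_i(ε_i) be a product probability density on ℝ^n where each π_i is a continuously differentiable probability density on ℝ and π_j is bounded. Let L : ℝ^n → ℝ be bounded measurable, and suppose there are K ∈ ℕ and measurable functions k'(w) ∈ {0,…,K}, b_1(w) < … < b_{k'(w)}(w), Δ_1(w), …, Δ_{k'(w)}(w), c(w) of w ∈ ℝ^{n−1}, with the Δ_s uniformly bounded, such that for almost every w ∈ ℝ^{n−1} and almost every t ∈ ℝ, L(z) = ∑_{s=1}^{k'(w)} Δ_s(w)·𝟙{t ≤ b_s(w)} + c(w), where z has j-th coordinate t and remaining coordinates w. Then the smoothed loss L^π(z, σ) = ∫_{ℝ^n} L(z + σε) π(ε) dε is differentiable in z_j and ∂L^π/∂z_j (z,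 σ) = −σ^{−1} ∫_{ℝ^{n−1}} [∑_{s=1}^{k'} Δ_s · π_j(σ^{−1}(b_s − z_j))] ∏_{i≠j} π_i(ε_i) dε_{∖j}, where k' , b_s, Δ_s are evaluated at w = z_{∖j} + σε_{∖j}. -/
open MeasureTheory Filter

theorem aux_split {n : ℕ} (j : Fin n) :
    ∃ e : (Fin n → ℝ) ≃ᵐ ℝ × ({i : Fin n // i ≠ j} → ℝ),
      MeasurePreserving e volume volume ∧ ∀ ε, e ε = (ε j, fun i => ε i.1) := by
  let e1 := MeasurableEquiv.piEquivPiSubtypeProd (fun _ : Fin n => ℝ) (fun i => i = j)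
  let e2 := MeasurableEquiv.funUnique {i : Fin n // i = j} ℝ
  have h1 : MeasurePreserving e1 volume volume := by
    convert volume_preserving_piEquivPiSubtypeProd (fun _ : Fin n => ℝ) (fun i => i = j)
    · rfl
    · rfl
  have h2 : MeasurePreserving e2 volume volume := by
    convert volume_preserving_funUnique {i : Fin n // i = j} ℝ
  refine ⟨e1.trans (e2.prodCongr (MeasurableEquiv.refl _)), ?_, fun ε => rfl⟩
  exact (h2.prod (MeasurePreserving.id _)).comp h1

theorem aux_cdf (p : ℝ → ℝ) (hc : Continuous p) (hi : Integrable p) (u : ℝ) :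
    HasDerivAt (fun u => ∫ x in Set.Iic u, p x) (p u) u := by
  have h : (fun u => ∫ x in Set.Iic u, p x)
      = fun u => (∫ x in (0:ℝ)..u, p x) + ∫ x in Set.Iic (0:ℝ), p x := by
    funext u
    rw [← intervalIntegral.integral_Iic_sub_Iic hi.integrableOn hi.integrableOn]
    ring
  rw [h]
  exact (intervalIntegral.integral_hasDerivAt_right (hc.intervalIntegrable _ _)
    (hc.stronglyMeasurableAtFilter _ _) hc.continuousAt).add_const _

theorem aux_qmp {ι : Type*} [Fintype ι] (z : ι → ℝ) {σ : ℝ} (hσ : 0 < σ) :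
    Measure.QuasiMeasurePreserving (fun η : ι → ℝ => (fun i => z i + σ * η i)) volume volume := by
  have h1 := Measure.quasiMeasurePreserving_smul (volume : Measure (ι → ℝ)) hσ.ne'
  have h2 := (measurePreserving_add_left (volume : Measure (ι → ℝ)) z).quasiMeasurePreserving
  exact h2.comp h1

theorem aux_qmp1 (t : ℝ) {σ : ℝ} (hσ : 0 < σ) :
    Measure.QuasiMeasurePreserving (fun x : ℝ => t + σ * x) volume volume := by
  have h1 := Measure.quasiMeasurePreserving_smul (volume : Measure ℝ) hσ.ne'
  have h2 := (measurePreserving_add_left (volume : Measure ℝ) t).quasiMeasurePreserving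
  exact h2.comp h1

/-- the one-dimensional inner integral -/
theorem aux_inner (p : ℝ → ℝ) (hi : Integrable p) (h1 : ∫ x, p x = 1)
    {σ : ℝ} (hσ : 0 < σ) (t : ℝ) (k : ℕ) (b Δ : ℕ → ℝ) (c : ℝ) (g : ℝ → ℝ)
    (hg : ∀ᵐ t, g t = (∑ s ∈ Finset.range k, Δ s * (if t ≤ b s then (1 : ℝ) else 0)) + c) :
    ∫ x, g (t + σ * x) * p x =
      (∑ s ∈ Finset.range k, Δ s * ∫ x in Set.Iic (σ⁻¹ * (b s - t)), p x) + c := by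
  have hae : ∀ᵐ x, g (t + σ * x) * p x = (∑ s ∈ Finset.range k,
      Δ s * (Set.Iic (σ⁻¹ * (b s - t))).indicator p x) + c * p x := by
    filter_upwards [(aux_qmp1 t hσ).ae hg] with x hx
    rw [hx, add_mul, Finset.sum_mul]
    congr 1
    refine Finset.sum_congr rfl fun s _ => ?_
    have : t + σ * x ≤ b s ↔ x ≤ σ⁻¹ * (b s - t) := by
      rw [inv_mul_eq_div, le_div_iff₀ hσ]
      constructor <;> intro h <;> linarith
    by_cases hh : x ≤ σ⁻¹ * (b s - t)
    · simp [Set.indicator, this, hh]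
    · simp [Set.indicator, this, hh]
  rw [integral_congr_ae hae, integral_add, integral_finsetSum]
  · simp only [integral_const_mul, integral_indicator measurableSet_Iic, h1, mul_one]
  · intro s _
    exact (hi.indicator measurableSet_Iic).const_mul _
  · exact integrable_finsetSum _ fun s _ => (hi.indicator measurableSet_Iic).const_mul _
  · exact hi.const_mul _

/-- Theorem 3 of the paper, Conditional Coordinate Sampling: for a product
smoothing density, the coordinate partial derivative of the smoothed discrete loss equals
an expectation over the off-coordinate noise of a finite sum of jump magnitudes weighted by
the coordinate density evaluated at the rescaled breaking points. -/
theorem stmt_5 (n : ℕ) (hn : 2 ≤ n) (σ : ℝ) (hσ : 0 < σ) (j : Fin n)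
    (π : Fin n → ℝ → ℝ)
    (hπ_cd : ∀ i, ContDiff ℝ 1 (π i))
    (hπ_nn : ∀ i x, 0 ≤ π i x)
    (hπ_int : ∀ i, ∫ x : ℝ, π i x = 1)
    (M : ℝ) (hπj_bdd : ∀ x, π j x ≤ M)
    (L : (Fin n → ℝ) → ℝ) (hL_meas : Measurable L) (l : ℝ) (hL_bdd : ∀ z, |L z| ≤ l)
    (K : ℕ)
    (k' : ({i : Fin n // i ≠ j} → ℝ) → ℕ)
    (b : ({i : Fin n // i ≠ j} → ℝ) → ℕ → ℝ)
    (Δ : ({i : Fin n // i ≠ j} → ℝ) → ℕ → ℝ)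
    (c : ({i : Fin n // i ≠ j} → ℝ) → ℝ)
    (hk'_meas : Measurable k')
    (hb_meas : ∀ s : ℕ, Measurable fun w => b w s)
    (hΔ_meas : ∀ s : ℕ, Measurable fun w => Δ w s)
    (hc_meas : Measurable c)
    (hk'_le : ∀ w, k' w ≤ K)
    (hb_mono : ∀ w, ∀ s t : ℕ, s < t → t < k' w → b w s < b w t)
    (DB : ℝ) (hΔ_bdd : ∀ w s, |Δ w s| ≤ DB)
    (hstep : ∀ᵐ w ∂(volume : Measure ({i : Fin n // i ≠ j} → ℝ)),
      ∀ᵐ t ∂(volume : Measure ℝ),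
        L (fun i => if h : i = j then t else w ⟨i, h⟩) =
          (∑ s ∈ Finset.range (k' w), Δ w s * (if t ≤ b w s then (1 : ℝ) else 0)) + c w) :
    ∀ z : Fin n → ℝ,
      HasDerivAt
        (fun t : ℝ =>
          ∫ ε : Fin n → ℝ, L (Function.update z j t + σ • ε) * ∏ i, π i (ε i))
        (-σ⁻¹ *
          ∫ η : {i : Fin n // i ≠ j} → ℝ,
            (∑ s ∈ Finset.range (k' fun i => z i.1 + σ * η i),
              Δ (fun i => z i.1 + σ * η i) s *
                π j (σ⁻¹ * (b (fun i => z i.1 + σ * η i) s - z j))) *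
            ∏ i : {i : Fin n // i ≠ j}, π i.1 (η i))
        (z j) := by
  intro z
  have hπi : ∀ i, Integrable (π i) := fun i => by
    by_contra h
    have := hπ_int i
    rw [integral_undef h] at this
    exact zero_ne_one this
  have hπc : ∀ i, Continuous (π i) := fun i => (hπ_cd i).continuous
  set W : ({i : Fin n // i ≠ j} → ℝ) → ({i : Fin n // i ≠ j} → ℝ) :=
    fun η i => z i.1 + σ * η i with hW
  set P : ({i : Fin n // i ≠ j} → ℝ) → ℝ := fun η => ∏ i, π i.1 (η i) with hP
  have hPi : Integrable P volume :=
    Integrable.fintype_prod (f := fun i : {i : Fin n // i ≠ j} => π i.1) fun i => hπi i.1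
  have hPnn : ∀ η, 0 ≤ P η := fun η => Finset.prod_nonneg fun i _ => hπ_nn _ _
  have hWm : Measurable W := by
    rw [hW]; fun_prop
  let A : ℝ × ({i : Fin n // i ≠ j} → ℝ) → (Fin n → ℝ) :=
    fun q i => if h : i = j then q.1 else q.2 ⟨i, h⟩
  have hA : Measurable A := by
    refine measurable_pi_lambda _ fun i => ?_
    by_cases h : i = j
    · simp only [A, h, dite_true]; exact measurable_fst
    · simp only [A, h, dite_false]; exact (measurable_pi_apply _).comp measurable_snd
  let G : ℝ → ℝ × ({i : Fin n // i ≠ j} → ℝ) → ℝ :=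
    fun t q => L (A (t + σ * q.1, W q.2)) * (π j q.1 * P q.2)
  have hGi : ∀ t, Integrable (G t) (volume.prod volume) := by
    intro t
    refine Integrable.bdd_mul (c := l) ((hπi j).mul_prod hPi) ?_ ?_
    · refine (hL_meas.comp (hA.comp ?_)).aestronglyMeasurable
      exact (measurable_const.add (measurable_const.mul measurable_fst)).prodMk
        (hWm.comp measurable_snd)
    · exact ae_of_all _ fun q => hL_bdd _
  obtain ⟨e, he, hee⟩ := aux_split j
  let F0 : ℝ → ({i : Fin n // i ≠ j} → ℝ) → ℝ := fun t η => ∫ x, G t (x, η)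
  have hF0i : ∀ t, Integrable (F0 t) volume := fun t => (hGi t).integral_prod_right
  let Φ : ℝ → ℝ := fun u => ∫ x in Set.Iic u, π j x
  let F : ℝ → ({i : Fin n // i ≠ j} → ℝ) → ℝ := fun t η =>
    ((∑ s ∈ Finset.range (k' (W η)), Δ (W η) s * Φ (σ⁻¹ * (b (W η) s - t))) + c (W η)) * P η
  have hFF0 : ∀ t, F0 t =ᵐ[volume] F t := by
    intro t
    filter_upwards [(aux_qmp (fun i : {i : Fin n // i ≠ j} => z i.1) hσ).ae hstep] with η hη
    have := aux_inner (π j) (hπi j) (hπ_int j) hσ t _ _ _ _ _ hη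
    simp only [F0, F, G, ← mul_assoc]
    rw [integral_mul_const]
    congr 1
  have hfun : (fun t : ℝ =>
      ∫ ε : Fin n → ℝ, L (Function.update z j t + σ • ε) * ∏ i, π i (ε i))
      = fun t => ∫ η, F t η := by
    funext t
    rw [← integral_congr_ae (hFF0 t)]
    have h1 := integral_prod_symm _ (hGi t)
    have h2 := he.integral_comp' (G t)
    refine Eq.trans ?_ (h2.trans h1)
    refine integral_congr_ae (ae_of_all _ fun ε => ?_)
    simp only [G, hee, hP]
    rw [Fintype.prod_eq_mul_prod_subtype_ne _ j]
    congr 2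
    funext i
    by_cases h : i = j
    · subst h; simp [A]
    · simp [A, h, hW]
  have hΦ : ∀ u, HasDerivAt Φ (π j u) u := aux_cdf (π j) (hπc j) (hπi j)
  let F' : ℝ → ({i : Fin n // i ≠ j} → ℝ) → ℝ := fun t η =>
    -σ⁻¹ * ((∑ s ∈ Finset.range (k' (W η)), Δ (W η) s * π j (σ⁻¹ * (b (W η) s - t))) * P η)
  have hder : ∀ η t, HasDerivAt (fun t => F t η) (F' t η) t := by
    intro η t
    have hs : ∀ s ∈ Finset.range (k' (W η)),
        HasDerivAt (fun t => Δ (W η) s * Φ (σ⁻¹ * (b (W η) s - t)))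
          (Δ (W η) s * (π j (σ⁻¹ * (b (W η) s - t)) * (σ⁻¹ * (-1)))) t := by
      intro s _
      exact ((hΦ _).comp t (((hasDerivAt_id t).const_sub _).const_mul _)).const_mul _
    have := ((HasDerivAt.fun_sum hs).add_const (c (W η))).mul_const (P η)
    refine this.congr_deriv ?_
    simp only [F', Finset.sum_mul, Finset.mul_sum]
    exact Finset.sum_congr rfl fun s _ => by ring
  have hmeas : AEStronglyMeasurable (F' (z j)) volume := by
    have hS : (fun η => ∑ s ∈ Finset.range (k' (W η)),
          Δ (W η) s * π j (σ⁻¹ * (b (W η) s - z j)))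
        = fun η => ∑ s ∈ Finset.range K, if s < k' (W η) then
          Δ (W η) s * π j (σ⁻¹ * (b (W η) s - z j)) else 0 := by
      funext η
      rw [← Finset.sum_filter]
      refine Finset.sum_congr ?_ fun _ _ => rfl
      ext s
      have := hk'_le (W η)
      simp only [Finset.mem_range, Finset.mem_filter]
      omega
    have hSm : Measurable (fun η => ∑ s ∈ Finset.range (k' (W η)),
          Δ (W η) s * π j (σ⁻¹ * (b (W η) s - z j))) := by
      rw [hS]
      refine Finset.measurable_fun_sum _ fun s _ => Measurable.ite ?_ ?_ measurable_const
      · exact measurableSet_lt measurable_const (hk'_meas.comp hWm)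
      · exact ((hΔ_meas s).comp hWm).mul ((hπc j).measurable.comp
          (measurable_const.mul (((hb_meas s).comp hWm).sub measurable_const)))
    exact (hSm.aestronglyMeasurable.mul hPi.aestronglyMeasurable).const_mul _
  have hDB : 0 ≤ DB := (abs_nonneg _).trans (hΔ_bdd 0 0)
  have hM : 0 ≤ M := (hπ_nn j 0).trans (hπj_bdd 0)
  have hbound : ∀ η t, ‖F' t η‖ ≤ σ⁻¹ * ((K * (DB * M)) * P η) := by
    intro η t
    have hσ' : 0 < σ⁻¹ := inv_pos.2 hσ
    simp only [F', Real.norm_eq_abs, abs_mul, abs_neg, abs_of_pos hσ', abs_of_nonneg (hPnn η)]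
    refine mul_le_mul_of_nonneg_left (mul_le_mul_of_nonneg_right ?_ (hPnn η)) hσ'.le
    refine (Finset.abs_sum_le_sum_abs _ _).trans ?_
    calc _ ≤ ∑ s ∈ Finset.range (k' (W η)), DB * M := by
          refine Finset.sum_le_sum fun s _ => ?_
          rw [abs_mul, abs_of_nonneg (hπ_nn j _)]
          exact mul_le_mul (hΔ_bdd _ _) (hπj_bdd _) (hπ_nn _ _) hDB
      _ = (k' (W η) : ℝ) * (DB * M) := by simp
      _ ≤ K * (DB * M) := mul_le_mul_of_nonneg_right (by exact_mod_cast hk'_le _)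
          (mul_nonneg hDB hM)
  have hmain := (hasDerivAt_integral_of_dominated_loc_of_deriv_le (F := F) (F' := F')
    (x₀ := z j) (s := Set.univ) (μ := volume) univ_mem
    (Eventually.of_forall fun t => ((hF0i t).congr (hFF0 t)).aestronglyMeasurable)
    ((hF0i _).congr (hFF0 _)) hmeas
    (ae_of_all _ fun η t _ => hbound η t) ((hPi.const_mul _).const_mul _)
    (ae_of_all _ fun η t _ => hder η t)).2
  rw [hfun]
  refine hmain.congr_deriv ?_
  exact integral_const_mul _ _
end

section
/- Under the hypotheses of the Conditional Coordinate Sampling derivative formula — namely L : ℝ^n → ℝ bounded by l (|L| ≤ l), π(ε) = ∏_i π_i(ε_i) a product of continuously differentiable one-dimensional probability densities with sup π_j ≤ M, and almost every coordinate-j section of L a step function with at most K jumps each of magnitude at most 2l — one has, for all z ∈ ℝ^n and σ > 0, |∂L^π/∂z_j (z, σ)| ≤ 2lKM/σ, where L^π(z, σ) = ∫_{ℝ^n} L(z + σε) π(ε) dε. -/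
open MeasureTheory Filter

theorem ae_affine {E : Type*} [NormedAddCommGroup E] [NormedSpace ℝ E] [MeasurableSpace E]
    [BorelSpace E] [FiniteDimensional ℝ E] (μ : Measure E) [μ.IsAddHaarMeasure]
    (P : E → Prop) (a : E) (σ : ℝ) (hσ : 0 < σ) (h : ∀ᵐ x ∂μ, P x) :
    ∀ᵐ x ∂μ, P (a + σ • x) := by
  rw [ae_iff] at h ⊢
  have : {x | ¬ P (a + σ • x)} = (fun x => σ • x) ⁻¹' ((fun x => a + x) ⁻¹' {x | ¬ P x}) := rfl
  rw [this, Measure.addHaar_preimage_smul μ hσ.ne', measure_preimage_add, h, mul_zero]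

theorem one_dim (g p : ℝ → ℝ) (hp0 : ∀ x, 0 ≤ p x) (M : ℝ) (hpM : ∀ x, p x ≤ M)
    (l : ℝ) (hl : 0 ≤ l) (K k : ℕ) (hk : k ≤ K) (b Δ : ℕ → ℝ) (c : ℝ)
    (hΔ : ∀ s, |Δ s| ≤ 2 * l)
    (hg : ∀ᵐ t ∂(volume : Measure ℝ), g t =
      (∑ s ∈ Finset.range k, Δ s * (if t ≤ b s then (1 : ℝ) else 0)) + c)
    (σ : ℝ) (hσ : 0 < σ) (t t' : ℝ) :
    ∫ x, |g (t + σ * x) - g (t' + σ * x)| * p x ≤ 2 * l * K * M / σ * |t - t'| := by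
  have hM : 0 ≤ M := (hp0 0).trans (hpM 0)
  have h1 := ae_affine volume _ t σ hσ hg
  have h2 := ae_affine volume _ t' σ hσ hg
  have key : ∀ s x : ℝ, |(if t + σ * x ≤ s then (1 : ℝ) else 0) -
      (if t' + σ * x ≤ s then (1 : ℝ) else 0)| ≤
      (Set.uIoc ((s - t') / σ) ((s - t) / σ)).indicator (fun _ => (1 : ℝ)) x := by
    intro s x
    have e1 : t + σ * x ≤ s ↔ x ≤ (s - t) / σ := by
      rw [le_div_iff₀ hσ]; constructor <;> intro h <;> linarith
    have e2 : t' + σ * x ≤ s ↔ x ≤ (s - t') / σ := by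
      rw [le_div_iff₀ hσ]; constructor <;> intro h <;> linarith
    simp only [e1, e2]
    have nn : 0 ≤ (Set.uIoc ((s - t') / σ) ((s - t) / σ)).indicator (fun _ => (1 : ℝ)) x :=
      Set.indicator_nonneg (by simp) _
    by_cases ha : x ≤ (s - t) / σ <;> by_cases hb : x ≤ (s - t') / σ
    · simpa [ha, hb] using nn
    · have hb' := not_le.1 hb
      rw [Set.indicator_of_mem (Set.mem_uIoc.2 (Or.inl ⟨hb', ha⟩))]
      simp [ha, hb]
    · have ha' := not_le.1 ha
      rw [Set.indicator_of_mem (Set.mem_uIoc.2 (Or.inr ⟨ha', hb⟩))]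
      simp [ha, hb]
    · simpa [ha, hb] using nn
  let G : ℝ → ℝ := fun x => ∑ s ∈ Finset.range k,
    (Set.uIoc ((b s - t') / σ) ((b s - t) / σ)).indicator (fun _ => (2 * l * M : ℝ)) x
  have hint : ∀ s ∈ Finset.range k, Integrable (fun x =>
    (Set.uIoc ((b s - t') / σ) ((b s - t) / σ)).indicator (fun _ => (2 * l * M : ℝ)) x) := by
    intro s _
    rw [integrable_indicator_iff measurableSet_uIoc]
    exact integrableOn_const (by simp [Real.volume_uIoc]) enorm_ne_top
  have hGint : Integrable G := integrable_finsetSum _ hint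
  have hle : ∫ x, |g (t + σ * x) - g (t' + σ * x)| * p x ≤ ∫ x, G x := by
    apply integral_mono_of_nonneg
    · exact Eventually.of_forall fun x => mul_nonneg (abs_nonneg _) (hp0 x)
    · exact hGint
    · filter_upwards [h1, h2] with x hx1 hx2
      simp only [smul_eq_mul] at hx1 hx2
      rw [hx1, hx2, add_sub_add_right_eq_sub, ← Finset.sum_sub_distrib]
      calc _ ≤ (∑ s ∈ Finset.range k, 2 * l *
            (Set.uIoc ((b s - t') / σ) ((b s - t) / σ)).indicator (fun _ => (1 : ℝ)) x) * M := by
            apply mul_le_mul _ (hpM x) (hp0 x)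
            · apply Finset.sum_nonneg
              intro s _
              exact mul_nonneg (by positivity) (Set.indicator_nonneg (by simp) _)
            · refine (Finset.abs_sum_le_sum_abs _ _).trans (Finset.sum_le_sum fun s _ => ?_)
              rw [← mul_sub, abs_mul]
              exact mul_le_mul (hΔ s) (key _ _) (abs_nonneg _) (by positivity)
        _ = G x := by
            simp only [G, Finset.sum_mul]
            refine Finset.sum_congr rfl fun s _ => ?_
            by_cases h : x ∈ Set.uIoc ((b s - t') / σ) ((b s - t) / σ)
            · simp [Set.indicator_of_mem h]
            · simp [Set.indicator_of_notMem h]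
  refine hle.trans ?_
  have hG : ∫ x, G x = k * (2 * l * M * (|t - t'| / σ)) := by
    simp only [G]
    rw [integral_finsetSum _ hint]
    have : ∀ s ∈ Finset.range k, ∫ x, (Set.uIoc ((b s - t') / σ) ((b s - t) / σ)).indicator
        (fun _ => (2 * l * M : ℝ)) x = 2 * l * M * (|t - t'| / σ) := by
      intro s _
      rw [integral_indicator measurableSet_uIoc, setIntegral_const, measureReal_def,
        Real.volume_uIoc, ENNReal.toReal_ofReal (abs_nonneg _), smul_eq_mul, ← sub_div,
        abs_div, abs_of_pos hσ, mul_comm, sub_sub_sub_cancel_left, abs_sub_comm]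
    rw [Finset.sum_congr rfl this]; simp
  rw [hG]
  have : (k : ℝ) * (2 * l * M * (|t - t'| / σ)) ≤ K * (2 * l * M * (|t - t'| / σ)) := by
    gcongr
  refine this.trans (le_of_eq ?_)
  ring

/-- the splitting of the coordinate j -/
theorem split_equiv (n : ℕ) (j : Fin n) :
    ∃ e : (ℝ × ({i : Fin n // i ≠ j} → ℝ)) ≃ᵐ (Fin n → ℝ),
      MeasurePreserving e (volume.prod volume) volume ∧
      ∀ x w, e (x, w) = fun i => if h : i = j then x else w ⟨i, h⟩ := by
  let e1 := (MeasurableEquiv.piEquivPiSubtypeProd (fun _ : Fin n => ℝ) (fun i => i = j)).symm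
  let e2 : (ℝ × ({i : Fin n // ¬ i = j} → ℝ)) ≃ᵐ
      ({i : Fin n // i = j} → ℝ) × ({i : Fin n // ¬ i = j} → ℝ) :=
    (MeasurableEquiv.funUnique {i : Fin n // i = j} ℝ).symm.prodCongr (MeasurableEquiv.refl _)
  refine ⟨e2.trans e1, ?_, ?_⟩
  · have m1 := (volume_preserving_piEquivPiSubtypeProd (fun _ : Fin n => ℝ) (fun i => i = j)).symm
    have m2 : ∀ inst : Fintype {i : Fin n // i = j}, MeasurePreserving e2 (volume.prod volume)
        ((@volume _ (@MeasureSpace.pi _ inst (fun _ => ℝ) _)).prod volume) := by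
      intro inst
      have m0 := (volume_preserving_funUnique {i : Fin n // i = j} ℝ).symm
      have hinst : inst = Unique.fintype := Subsingleton.elim _ _
      subst hinst
      exact m0.prod (MeasurePreserving.id (volume : Measure ({i : Fin n // ¬ i = j} → ℝ)))
    exact m1.comp (m2 _)
  · intro x w
    rfl

/-- under the hypotheses of the Conditional Coordinate Sampling derivative
formula, the coordinate partial derivative of the smoothed loss is uniformly bounded by
2lKM/σ. -/
theorem stmt_6 (n : ℕ) (hn : 2 ≤ n) (j : Fin n)
    (π : Fin n → ℝ → ℝ)
    (hπ_cd : ∀ i, ContDiff ℝ 1 (π i))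
    (hπ_nn : ∀ i x, 0 ≤ π i x)
    (hπ_int : ∀ i, ∫ x : ℝ, π i x = 1)
    (M : ℝ) (hπj_bdd : ∀ x, π j x ≤ M)
    (L : (Fin n → ℝ) → ℝ) (hL_meas : Measurable L) (l : ℝ) (hL_bdd : ∀ z, |L z| ≤ l)
    (K : ℕ)
    (k' : ({i : Fin n // i ≠ j} → ℝ) → ℕ)
    (b : ({i : Fin n // i ≠ j} → ℝ) → ℕ → ℝ)
    (Δ : ({i : Fin n // i ≠ j} → ℝ) → ℕ → ℝ)
    (c : ({i : Fin n // i ≠ j} → ℝ) → ℝ)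
    (hk'_meas : Measurable k')
    (hb_meas : ∀ s : ℕ, Measurable fun w => b w s)
    (hΔ_meas : ∀ s : ℕ, Measurable fun w => Δ w s)
    (hc_meas : Measurable c)
    (hk'_le : ∀ w, k' w ≤ K)
    (hb_mono : ∀ w, ∀ s t : ℕ, s < t → t < k' w → b w s < b w t)
    (hΔ_bdd : ∀ w s, |Δ w s| ≤ 2 * l)
    (hstep : ∀ᵐ w ∂(volume : Measure ({i : Fin n // i ≠ j} → ℝ)),
      ∀ᵐ t ∂(volume : Measure ℝ),
        L (fun i => if h : i = j then t else w ⟨i, h⟩) =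
          (∑ s ∈ Finset.range (k' w), Δ w s * (if t ≤ b w s then (1 : ℝ) else 0)) + c w) :
    ∀ (z : Fin n → ℝ) (σ : ℝ), 0 < σ → ∀ d : ℝ,
      HasDerivAt
        (fun t : ℝ =>
          ∫ ε : Fin n → ℝ, L (Function.update z j t + σ • ε) * ∏ i, π i (ε i))
        d (z j) →
      |d| ≤ 2 * l * K * M / σ := by
  intro z σ hσ d hd
  have hl : 0 ≤ l := (abs_nonneg _).trans (hL_bdd z)
  have hM : 0 ≤ M := (hπ_nn j 0).trans (hπj_bdd 0)
  have hπI : ∀ i, Integrable (π i) := by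
    intro i
    by_contra h
    have := hπ_int i
    rw [integral_undef h] at this
    exact zero_ne_one this
  have hprod : Integrable (fun ε : Fin n → ℝ => ∏ i, π i (ε i)) :=
    Integrable.fintype_prod (f := π) hπI
  have hI : ∀ t : ℝ, Integrable (fun ε : Fin n → ℝ =>
      L (Function.update z j t + σ • ε) * ∏ i, π i (ε i)) := by
    intro t
    refine hprod.bdd_mul (c := l) ?_ (Eventually.of_forall fun ε => hL_bdd _)
    exact (hL_meas.comp (by fun_prop)).aestronglyMeasurable
  refine hd.le_of_lip' (by positivity) (Eventually.of_forall fun t => ?_)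
  generalize z j = t'
  simp only [Real.norm_eq_abs]
  rw [← integral_sub (hI t) (hI t')]
  obtain ⟨e, he, hev⟩ := split_equiv n j
  let G : (Fin n → ℝ) → ℝ := fun ε =>
    |L (Function.update z j t + σ • ε) - L (Function.update z j t' + σ • ε)| * ∏ i, π i (ε i)
  have hGeq : ∀ ε, |L (Function.update z j t + σ • ε) * ∏ i, π i (ε i) -
      L (Function.update z j t' + σ • ε) * ∏ i, π i (ε i)| = G ε := by
    intro ε
    rw [← sub_mul, abs_mul, abs_of_nonneg (Finset.prod_nonneg fun i _ => hπ_nn i _)]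
  have hGI : Integrable G := by
    have := ((hI t).sub (hI t')).abs
    exact this.congr (Eventually.of_forall hGeq)
  refine (abs_integral_le_integral_abs).trans ?_
  simp only [hGeq]
  rw [← he.integral_comp' G, integral_prod_symm (fun x => G (e x))
    ((he.integrable_comp_emb e.measurableEmbedding).2 hGI)]
  let Q : ({i : Fin n // i ≠ j} → ℝ) → ℝ := fun w => ∏ i, π i.1 (w i)
  have hQ0 : ∀ w, 0 ≤ Q w := fun w => Finset.prod_nonneg fun i _ => hπ_nn _ _
  have hQI : Integrable Q :=
    Integrable.fintype_prod (f := fun i : {i : Fin n // i ≠ j} => π i.1) fun i => hπI i.1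
  have hQ1 : ∫ w, Q w = 1 := by
    have := integral_fintype_prod_volume_eq_prod (𝕜 := ℝ)
      (fun i : {i : Fin n // i ≠ j} => π i.1)
    simp only [Q]
    rw [this]
    simp [hπ_int]
  let z' : {i : Fin n // i ≠ j} → ℝ := fun i => z i.1
  have hst := ae_affine volume _ z' σ hσ hstep
  have hpt : ∀ w x, ∀ t : ℝ, Function.update z j t + σ • e (x, w) =
      fun i => if h : i = j then t + σ * x else (z' + σ • w) ⟨i, h⟩ := by
    intro w x t
    rw [hev]
    funext i
    by_cases h : i = j
    · subst h; simp
    · simp [h, z']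
  have hpr : ∀ w x, ∏ i, π i (e (x, w) i) = π j x * Q w := by
    intro w x
    rw [Fintype.prod_eq_mul_prod_subtype_ne _ j, hev]
    simp only [dif_pos, Q]
    congr 1
    refine Finset.prod_congr rfl fun i _ => ?_
    simp [i.2]
  have hmain : ∫ w, ∫ x, G (e (x, w)) ≤ ∫ w, (2 * l * K * M / σ * |t - t'|) * Q w := by
    apply integral_mono_of_nonneg
    · refine Eventually.of_forall fun w => integral_nonneg fun x => ?_
      exact mul_nonneg (abs_nonneg _) (Finset.prod_nonneg fun i _ => hπ_nn i _)
    · exact hQI.const_mul _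
    · filter_upwards [hst] with w hw
      have h1 := one_dim _ (π j) (hπ_nn j) M hπj_bdd l hl K _ (hk'_le _) _ _ _ (hΔ_bdd _) hw
        σ hσ t t'
      simp only [G, hpt, hpr, ← mul_assoc]
      rw [integral_mul_const]
      exact mul_le_mul_of_nonneg_right h1 (hQ0 w)
  refine hmain.trans ?_
  rw [integral_const_mul, hQ1, mul_one]
end

section
/- Let L : ℝ^n → ℝ be measurable with |L(z)| ≤ l for all z, and let π be a continuously differentiable probability density on ℝ^n with uniformly bounded gradient satisfying ‖∇π(ε)‖ ≤ C‖ε‖^{−n−2} for ‖ε‖ ≥ 1 (for some C > 0), so that I := ∫_{ℝ^n} ‖∇π(ε)‖·‖ε‖ dε < ∞. Then the smoothed loss L^π(z, σ) = ∫_{ℝ^n} L(z + σε) π(ε) dε is differentiable in σ and |∂L^π/∂σ (z, σ)| ≤ σ^{−1} l (n + I) for all z ∈ ℝ^n and σ > 0. -/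
open MeasureTheory Filter

/-- the σ-derivative of the smoothed loss exists and is uniformly bounded by
σ⁻¹ l (n + I) where I = ∫ ‖∇π(ε)‖ ‖ε‖ dε. -/
theorem stmt_8 (n : ℕ) (hn : 0 < n)
    (L : EuclideanSpace ℝ (Fin n) → ℝ) (hL_meas : Measurable L)
    (l : ℝ) (hL_bdd : ∀ z, |L z| ≤ l)
    (π : EuclideanSpace ℝ (Fin n) → ℝ) (hπ_cd : ContDiff ℝ 1 π)
    (hπ_nn : ∀ ε, 0 ≤ π ε) (hπ_int : ∫ ε, π ε = 1)
    (C₀ : ℝ) (hgrad_bdd : ∀ ε, ‖gradient π ε‖ ≤ C₀)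
    (C : ℝ) (hC : 0 < C)
    (hdecay : ∀ ε : EuclideanSpace ℝ (Fin n), 1 ≤ ‖ε‖ →
      ‖gradient π ε‖ ≤ C * ‖ε‖ ^ (-(n : ℝ) - 2)) :
    ∀ (z : EuclideanSpace ℝ (Fin n)) (σ : ℝ), 0 < σ → ∃ d : ℝ,
      HasDerivAt (fun s : ℝ => ∫ ε, L (z + s • ε) * π ε) d σ ∧
      |d| ≤ σ⁻¹ * l * (n + ∫ ε, ‖gradient π ε‖ * ‖ε‖) := by
  intro z σ hσ
  have hl : 0 ≤ l := (abs_nonneg _).trans (hL_bdd 0)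
  have hC0 : 0 ≤ C₀ := (norm_nonneg _).trans (hgrad_bdd 0)
  have hfr : Module.finrank ℝ (EuclideanSpace ℝ (Fin n)) = n := by simp
  have hπi : Integrable π := by
    by_contra h
    rw [integral_undef h] at hπ_int
    norm_num at hπ_int
  have hng : ∀ ε, ‖fderiv ℝ π ε‖ = ‖gradient π ε‖ := by
    intro ε
    rw [← toDual_gradient, LinearIsometryEquiv.norm_map]
  have hcf : Continuous (fderiv ℝ π) := hπ_cd.continuous_fderiv (by norm_num)
  have hcg : Continuous (fun ε => ‖gradient π ε‖) := by
    simp only [← hng]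
    exact hcf.norm
  -- the dominating function
  set h : EuclideanSpace ℝ (Fin n) → ℝ :=
    fun ε => 2 * (C₀ + C) * ((1 + ‖ε‖) / 2) ^ (-((n : ℝ) + 1)) with hh
  have hhi : Integrable h := by
    have h1 : Integrable (fun x : EuclideanSpace ℝ (Fin n) => (1 + ‖x‖) ^ (-((n : ℝ) + 1))) :=
      integrable_one_add_norm (by rw [hfr]; linarith)
    have h2 : h = fun x => (2 * (C₀ + C) * (2 : ℝ)⁻¹ ^ (-((n : ℝ) + 1))) *
        (1 + ‖x‖) ^ (-((n : ℝ) + 1)) := by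
      funext x
      simp only [hh]
      rw [div_eq_mul_inv, Real.mul_rpow (by positivity) (by norm_num)]
      ring
    rw [h2]
    exact h1.const_mul _
  have hgb : ∀ ε, ‖gradient π ε‖ * (1 + ‖ε‖) ≤ h ε := by
    intro ε
    have hpos : 0 < (1 + ‖ε‖) / 2 := by positivity
    have key : ‖gradient π ε‖ ≤ (C₀ + C) * ((1 + ‖ε‖) / 2) ^ (-(n : ℝ) - 2) := by
      rcases le_or_gt 1 ‖ε‖ with h1 | h1
      · refine (hdecay ε h1).trans ?_
        apply mul_le_mul (by linarith) _ (by positivity) (by positivity)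
        apply Real.rpow_le_rpow_of_nonpos hpos (by linarith)
        have : (0 : ℝ) ≤ n := by positivity
        linarith
      · refine (hgrad_bdd ε).trans ?_
        have : (1 : ℝ) ≤ ((1 + ‖ε‖) / 2) ^ (-(n : ℝ) - 2) := by
          apply Real.one_le_rpow_of_pos_of_le_one_of_nonpos hpos (by linarith)
          have : (0 : ℝ) ≤ n := by positivity
          linarith
        nlinarith
    have e : ((1 + ‖ε‖) / 2) ^ (-((n : ℝ) + 1)) =
        ((1 + ‖ε‖) / 2) ^ (-(n : ℝ) - 2) * ((1 + ‖ε‖) / 2) := by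
      rw [← Real.rpow_add_one hpos.ne']
      congr 1
      ring
    simp only [hh]
    rw [e]
    have := mul_le_mul_of_nonneg_right key (by positivity : 0 ≤ 1 + ‖ε‖)
    linarith
  have hmono : ∀ x y : EuclideanSpace ℝ (Fin n), ‖x‖ ≤ ‖y‖ → h y ≤ h x := by
    intro x y hxy
    simp only [hh]
    apply mul_le_mul_of_nonneg_left _ (by positivity)
    apply Real.rpow_le_rpow_of_nonpos (by positivity) (by linarith)
    have : (0 : ℝ) ≤ n := by positivity
    linarith
  have hIi : Integrable (fun ε => ‖gradient π ε‖ * ‖ε‖) := by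
    refine hhi.mono' (hcg.mul continuous_norm).aestronglyMeasurable (ae_of_all _ fun ε => ?_)
    rw [Real.norm_of_nonneg (by positivity)]
    refine le_trans ?_ (hgb ε)
    exact mul_le_mul_of_nonneg_left (by linarith) (norm_nonneg _)
  set I := ∫ ε, ‖gradient π ε‖ * ‖ε‖ with hI
  have hLz : Measurable (fun u => L (z + u)) := hL_meas.comp (measurable_const_add z)
  set τ := σ⁻¹ with hτ
  have hτ0 : 0 < τ := inv_pos.2 hσ
  set G : ℝ → ℝ := fun t => ∫ u, L (z + u) * π (t • u) with hG
  set G' : ℝ := ∫ u, L (z + u) * fderiv ℝ π (τ • u) u with hG'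
  have hGd : HasDerivAt G G' τ := by
    have ha : 0 < τ / 2 := by positivity
    refine (hasDerivAt_integral_of_dominated_loc_of_deriv_le (μ := volume)
      (F := fun t u => L (z + u) * π (t • u))
      (F' := fun t u => L (z + u) * fderiv ℝ π (t • u) u)
      (bound := fun u => l * ((τ / 2)⁻¹ * h ((τ / 2) • u)))
      (s := Set.Ioi (τ / 2)) (Ioi_mem_nhds (by linarith)) ?_ ?_ ?_ ?_ ?_ ?_).2
    · refine Eventually.of_forall fun t => ?_
      exact (hLz.mul (hπ_cd.continuous.comp (continuous_const_smul t)).measurable).aestronglyMeasurable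
    · exact (hπi.comp_smul hτ0.ne').bdd_mul (c := l) hLz.aestronglyMeasurable
        (ae_of_all _ fun u => hL_bdd _)
    · have : Continuous fun u : EuclideanSpace ℝ (Fin n) => fderiv ℝ π (τ • u) u :=
        (hcf.comp (continuous_const_smul τ)).clm_apply continuous_id
      exact (hLz.mul this.measurable).aestronglyMeasurable
    · refine ae_of_all _ fun u t ht => ?_
      have ht' : τ / 2 < t := ht
      rw [norm_mul]
      refine mul_le_mul (hL_bdd _) ?_ (norm_nonneg _) hl
      refine (ContinuousLinearMap.le_opNorm _ _).trans ?_
      rw [hng]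
      have hn1 : ‖t • u‖ = t * ‖u‖ := by
        rw [norm_smul, Real.norm_of_nonneg (by linarith)]
      have hn2 : ‖(τ / 2) • u‖ = (τ / 2) * ‖u‖ := by
        rw [norm_smul, Real.norm_of_nonneg (by linarith)]
      have hle : (τ / 2) * ‖u‖ ≤ t * ‖u‖ := mul_le_mul_of_nonneg_right ht'.le (norm_nonneg _)
      have h3 := (hgb (t • u)).trans (hmono ((τ / 2) • u) (t • u) (by rw [hn1, hn2]; exact hle))
      rw [le_inv_mul_iff₀ ha]
      refine le_trans ?_ h3
      have : ‖gradient π (t • u)‖ * ((τ / 2) * ‖u‖) ≤ ‖gradient π (t • u)‖ * (1 + ‖t • u‖) :=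
        mul_le_mul_of_nonneg_left (by rw [hn1]; linarith) (norm_nonneg _)
      linarith
    · exact ((hhi.comp_smul ha.ne').const_mul _).const_mul _
    · refine ae_of_all _ fun u t _ => ?_
      have h1 : HasDerivAt (fun t : ℝ => t • u) u t := by
        simpa using (hasDerivAt_id t).smul_const u
      have h2 : HasFDerivAt π (fderiv ℝ π (t • u)) (t • u) :=
        (hπ_cd.differentiable (by norm_num) _).hasFDerivAt
      exact (h2.comp_hasDerivAt t h1).const_mul _
  have hGb : |G τ| ≤ l * (τ ^ n)⁻¹ := by
    have h1 : ‖G τ‖ ≤ ∫ u, l * π (τ • u) := by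
      refine norm_integral_le_of_norm_le ((hπi.comp_smul hτ0.ne').const_mul l)
        (ae_of_all _ fun u => ?_)
      rw [norm_mul, Real.norm_of_nonneg (hπ_nn _)]
      exact mul_le_mul_of_nonneg_right (hL_bdd _) (hπ_nn _)
    rw [integral_const_mul, Measure.integral_comp_smul volume π τ, hfr, hπ_int,
      abs_of_pos (by positivity)] at h1
    simpa using h1
  have hGb' : |G'| ≤ l * (τ⁻¹ * ((τ ^ n)⁻¹ * I)) := by
    have h1 : ‖G'‖ ≤ ∫ u, l * (τ⁻¹ * (‖gradient π (τ • u)‖ * ‖τ • u‖)) := by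
      refine norm_integral_le_of_norm_le
        (((hIi.comp_smul hτ0.ne').const_mul _).const_mul l) (ae_of_all _ fun u => ?_)
      rw [norm_mul]
      refine mul_le_mul (hL_bdd _) ?_ (norm_nonneg _) hl
      refine (ContinuousLinearMap.le_opNorm _ _).trans ?_
      rw [hng, norm_smul, Real.norm_of_nonneg hτ0.le]
      apply le_of_eq
      field_simp
    rw [integral_const_mul, integral_const_mul,
      Measure.integral_comp_smul volume (fun ε => ‖gradient π ε‖ * ‖ε‖) τ, hfr,
      abs_of_pos (by positivity)] at h1
    simpa using h1
  have hF : (fun s : ℝ => ∫ ε, L (z + s • ε) * π ε) =ᶠ[nhds σ] fun s => (s⁻¹) ^ n * G s⁻¹ := by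
    filter_upwards [Ioi_mem_nhds hσ] with s hs
    have hs0 : 0 < s := hs
    have := Measure.integral_comp_smul volume (fun u => L (z + u) * π (s⁻¹ • u)) s
    simp only [smul_smul, inv_mul_cancel₀ hs0.ne', one_smul] at this
    rw [this, hfr, abs_of_pos (by positivity), inv_pow, smul_eq_mul]
  have hinv : HasDerivAt (fun s : ℝ => s⁻¹) (-(σ ^ 2)⁻¹) σ := hasDerivAt_inv hσ.ne'
  have hcomp : HasDerivAt (fun s : ℝ => G s⁻¹) (G' * -(σ ^ 2)⁻¹) σ :=
    HasDerivAt.comp σ (h₂ := G) hGd hinv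
  have hd := ((hinv.pow n).mul hcomp).congr_of_eventuallyEq hF
  refine ⟨_, hd, ?_⟩
  have hσ2 : (σ ^ 2)⁻¹ = τ ^ 2 := by rw [hτ, inv_pow]
  have hpow : τ ^ n = τ ^ (n - 1) * τ := by
    rw [← pow_succ, Nat.sub_add_cancel hn]
  simp only [Pi.pow_apply]
  rw [← hτ, hσ2]
  refine (abs_add_le _ _).trans ?_
  have e1 : |(n : ℝ) * τ ^ (n - 1) * -τ ^ 2 * G τ| = n * τ ^ n * τ * |G τ| := by
    rw [abs_mul, mul_neg, abs_neg, abs_of_nonneg (by positivity), hpow]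
    ring
  have e2 : |τ ^ n * (G' * -τ ^ 2)| = τ ^ n * τ ^ 2 * |G'| := by
    rw [mul_neg, mul_neg, abs_neg, ← mul_assoc, mul_right_comm, abs_mul,
      abs_of_nonneg (by positivity : 0 ≤ τ ^ n * τ ^ 2)]
  rw [e1, e2]
  have b1 := mul_le_mul_of_nonneg_left hGb (by positivity : 0 ≤ (n : ℝ) * τ ^ n * τ)
  have b2 := mul_le_mul_of_nonneg_left hGb' (by positivity : 0 ≤ τ ^ n * τ ^ 2)
  refine (add_le_add b1 b2).trans (le_of_eq ?_)
  have : τ ^ n ≠ 0 := by positivity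
  clear_value τ
  field_simp
end

section
/- Let L : ℝ^n → ℝ be bounded measurable with |L| ≤ l and scale-free (L(λz) = L(z) for all λ > 0), and let π be a continuously differentiable probability density on ℝ^n with uniformly bounded gradient satisfying ‖∇π(ε)‖ ≤ C‖ε‖^{−n−2} for ‖ε‖ ≥ 1, and set I := ∫ ‖∇π(ε)‖·‖ε‖ dε < ∞. If the smoothed loss L^π(z, σ) = ∫ L(z + σε) π(ε) dε is continuously differentiable on ℝ^n × (0, ∞), then |⟨∇_z L^π(z, σ), z⟩| ≤ l(n + I) for all z ∈ ℝ^n and all σ > 0; in particular this bound is independent of σ. -/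
open MeasureTheory Filter RealInnerProductSpace

lemma aux_norm_grad {n : ℕ} (f : EuclideanSpace ℝ (Fin n) → ℝ) (x : EuclideanSpace ℝ (Fin n)) :
    ‖gradient f x‖ = ‖fderiv ℝ f x‖ := by
  simp [gradient]

lemma aux_integrable {n : ℕ}
    (π : EuclideanSpace ℝ (Fin n) → ℝ) (hπ_cd : ContDiff ℝ 1 π)
    (C₀ : ℝ) (hgrad_bdd : ∀ ε, ‖gradient π ε‖ ≤ C₀)
    (C : ℝ) (hC : 0 < C)
    (hdecay : ∀ ε : EuclideanSpace ℝ (Fin n), 1 ≤ ‖ε‖ →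
      ‖gradient π ε‖ ≤ C * ‖ε‖ ^ (-(n : ℝ) - 2)) :
    Integrable (fun ε => ‖gradient π ε‖ * ‖ε‖) := by
  have hc : Continuous (fun ε => ‖gradient π ε‖ * ‖ε‖) := by
    simp only [aux_norm_grad]
    exact ((hπ_cd.continuous_fderiv one_ne_zero).norm).mul continuous_norm
  have hC0 : 0 ≤ C₀ := (norm_nonneg _).trans (hgrad_bdd 0)
  have hI : Integrable (fun x : EuclideanSpace ℝ (Fin n) => (1 + ‖x‖) ^ (-((n : ℝ) + 1))) :=
    integrable_one_add_norm (by simp)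
  refine (hI.const_mul ((C₀ + C) * 2 ^ ((n : ℝ) + 1))).mono' hc.aestronglyMeasurable
    (Eventually.of_forall fun ε => ?_)
  rw [Real.norm_of_nonneg (by positivity)]
  have hpos : 0 < 1 + ‖ε‖ := by positivity
  rcases le_total 1 ‖ε‖ with h | h
  · have h0 : 0 < ‖ε‖ := by linarith
    have h1 : ‖gradient π ε‖ * ‖ε‖ ≤ C * ‖ε‖ ^ (-((n : ℝ) + 1)) := by
      calc _ ≤ C * ‖ε‖ ^ (-(n : ℝ) - 2) * ‖ε‖ := by gcongr; exact hdecay ε h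
        _ = _ := by
          rw [mul_assoc, ← Real.rpow_add_one h0.ne']
          ring_nf
    have h2 : ‖ε‖ ^ (-((n : ℝ) + 1)) ≤ 2 ^ ((n : ℝ) + 1) * (1 + ‖ε‖) ^ (-((n : ℝ) + 1)) := by
      have : ((1 + ‖ε‖) / 2) ^ ((n : ℝ) + 1) ≤ ‖ε‖ ^ ((n : ℝ) + 1) :=
        Real.rpow_le_rpow (by positivity) (by linarith) (by positivity)
      rw [Real.div_rpow (by positivity) (by positivity)] at this
      rw [Real.rpow_neg h0.le, Real.rpow_neg hpos.le, ← div_eq_mul_inv,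
        ← inv_div]
      exact inv_anti₀ (by positivity) this
    calc _ ≤ C * ‖ε‖ ^ (-((n : ℝ) + 1)) := h1
      _ ≤ (C₀ + C) * (2 ^ ((n : ℝ) + 1) * (1 + ‖ε‖) ^ (-((n : ℝ) + 1))) := by
        gcongr
        linarith
      _ = _ := by ring
  · have h2 : 1 ≤ 2 ^ ((n : ℝ) + 1) * (1 + ‖ε‖) ^ (-((n : ℝ) + 1)) := by
      rw [Real.rpow_neg hpos.le, ← div_eq_mul_inv, one_le_div (by positivity)]
      exact Real.rpow_le_rpow (by positivity) (by linarith) (by positivity)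
    calc _ ≤ C₀ * 1 := by gcongr; exact hgrad_bdd ε
      _ ≤ (C₀ + C) * (2 ^ ((n : ℝ) + 1) * (1 + ‖ε‖) ^ (-((n : ℝ) + 1))) := by
        gcongr
        linarith
      _ = _ := by ring

lemma aux_pt {n : ℕ} (π : EuclideanSpace ℝ (Fin n) → ℝ) (hπ_cd : ContDiff ℝ 1 π)
    (hπ_nn : ∀ ε, 0 ≤ π ε) (t : ℝ) (ht : 1 ≤ t) (η : EuclideanSpace ℝ (Fin n)) :
    ‖t ^ n * π (t • η) - π η‖ₑ ≤ ∫⁻ s in Set.Ioc 1 t,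
      ENNReal.ofReal (s ^ n * (n * π (s • η) + ‖gradient π (s • η)‖ * ‖s • η‖)) := by
  have hd : ∀ s : ℝ, HasDerivAt (fun s : ℝ => s ^ n * π (s • η))
      ((n * s ^ (n - 1)) * π (s • η) + s ^ n * fderiv ℝ π (s • η) η) s := by
    intro s
    have h1 : HasDerivAt (fun s : ℝ => s • η) η s := by
      simpa using (hasDerivAt_id s).smul_const η
    have h2 := ((hπ_cd.differentiable one_ne_zero) (s • η)).hasFDerivAt.comp_hasDerivAt s h1
    exact (hasDerivAt_pow n s).mul h2
  have hcf := hπ_cd.continuous_fderiv one_ne_zero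
  have hc0 := hπ_cd.continuous
  have hcont : Continuous (fun s : ℝ =>
      (n * s ^ (n - 1)) * π (s • η) + s ^ n * fderiv ℝ π (s • η) η) := by
    fun_prop
  have hFTC := intervalIntegral.integral_eq_sub_of_hasDerivAt (a := 1) (b := t)
    (fun s _ => hd s) (hcont.intervalIntegrable _ _)
  have : t ^ n * π (t • η) - π η = ∫ s in Set.Ioc 1 t,
      ((n * s ^ (n - 1)) * π (s • η) + s ^ n * fderiv ℝ π (s • η) η) := by
    rw [← intervalIntegral.integral_of_le ht, hFTC]; simp
  rw [this]
  refine (enorm_integral_le_lintegral_enorm _).trans ?_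
  refine setLIntegral_mono' measurableSet_Ioc fun s hs => ?_
  have hs1 : 1 ≤ s := hs.1.le
  have hs0 : 0 ≤ s := by linarith
  rw [← ofReal_norm]
  apply ENNReal.ofReal_le_ofReal
  refine (norm_add_le _ _).trans ?_
  rw [mul_add]
  refine add_le_add ?_ ?_
  · rw [Real.norm_of_nonneg (mul_nonneg (by positivity) (hπ_nn _))]
    have : s ^ (n-1) ≤ s ^ n := pow_le_pow_right₀ hs1 (by omega)
    have h3 := mul_le_mul_of_nonneg_right this (mul_nonneg (Nat.cast_nonneg (α := ℝ) n) (hπ_nn (s • η)))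
    linarith
  · rw [norm_mul, Real.norm_of_nonneg (pow_nonneg hs0 n), aux_norm_grad]
    gcongr
    refine (ContinuousLinearMap.le_opNorm _ _).trans ?_
    gcongr
    rw [norm_smul, Real.norm_of_nonneg hs0]
    exact le_mul_of_one_le_left (norm_nonneg _) hs1

lemma aux_L1 {n : ℕ} (π : EuclideanSpace ℝ (Fin n) → ℝ) (hπ_cd : ContDiff ℝ 1 π)
    (hπ_nn : ∀ ε, 0 ≤ π ε) (hπ_int : ∫ ε, π ε = 1)
    (hI : Integrable (fun ε => ‖gradient π ε‖ * ‖ε‖)) (t : ℝ) (ht : 1 ≤ t) :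
    ∫⁻ η, ‖t ^ n * π (t • η) - π η‖ₑ ≤
      ENNReal.ofReal ((n + ∫ ε, ‖gradient π ε‖ * ‖ε‖) * (t - 1)) := by
  have hπI : Integrable π := by
    by_contra h
    rw [integral_undef h] at hπ_int
    exact zero_ne_one hπ_int
  have hInn : 0 ≤ ∫ ε, ‖gradient π ε‖ * ‖ε‖ := integral_nonneg fun _ => by positivity
  refine (lintegral_mono (aux_pt π hπ_cd hπ_nn t ht)).trans ?_
  rw [lintegral_lintegral_swap]
  · have key : ∀ s ∈ Set.Ioc 1 t, ∫⁻ η : EuclideanSpace ℝ (Fin n),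
        ENNReal.ofReal (s ^ n * (n * π (s • η) + ‖gradient π (s • η)‖ * ‖s • η‖)) =
        ENNReal.ofReal (n + ∫ ε, ‖gradient π ε‖ * ‖ε‖) := by
      intro s hs
      have hs0 : 0 < s := by linarith [hs.1]
      have hh : Integrable (fun x : EuclideanSpace ℝ (Fin n) => n * π x + ‖gradient π x‖ * ‖x‖) :=
        (hπI.const_mul _).add hI
      have hh' := (hh.comp_smul hs0.ne').const_mul (s ^ n)
      rw [← ofReal_integral_eq_lintegral_ofReal hh' (Eventually.of_forall fun η =>
        mul_nonneg (by positivity) (add_nonneg (mul_nonneg (by positivity) (hπ_nn _))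
          (by positivity)))]
      congr 1
      rw [integral_const_mul, Measure.integral_comp_smul volume
        (fun x : EuclideanSpace ℝ (Fin n) => n * π x + ‖gradient π x‖ * ‖x‖) s,
        integral_add (hπI.const_mul _) hI, integral_const_mul, hπ_int]
      have : 0 < s ^ n := by positivity
      simp only [finrank_euclideanSpace, Fintype.card_fin, smul_eq_mul, abs_inv, abs_of_pos this]
      field_simp
    rw [setLIntegral_congr_fun measurableSet_Ioc key]
    rw [setLIntegral_const, Real.volume_Ioc, ENNReal.ofReal_mul (by positivity)]
  · have hcf := hπ_cd.continuous_fderiv one_ne_zero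
    have hc0 := hπ_cd.continuous
    simp only [aux_norm_grad]
    refine Measurable.aemeasurable (Continuous.measurable ?_)
    unfold Function.uncurry
    refine ENNReal.continuous_ofReal.comp ?_
    fun_prop

lemma aux_main {n : ℕ}
    (L : EuclideanSpace ℝ (Fin n) → ℝ) (hL_meas : Measurable L)
    (l : ℝ) (hL_bdd : ∀ z, |L z| ≤ l)
    (hL_sf : ∀ lam : ℝ, 0 < lam → ∀ z, L (lam • z) = L z)
    (π : EuclideanSpace ℝ (Fin n) → ℝ) (hπ_cd : ContDiff ℝ 1 π)
    (hπ_nn : ∀ ε, 0 ≤ π ε) (hπ_int : ∫ ε, π ε = 1)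
    (hI : Integrable (fun ε => ‖gradient π ε‖ * ‖ε‖))
    (z : EuclideanSpace ℝ (Fin n)) (σ t : ℝ) (ht : 1 ≤ t) :
    |(∫ ε, L (t • z + σ • ε) * π ε) - ∫ ε, L (z + σ • ε) * π ε| ≤
      l * (n + ∫ ε, ‖gradient π ε‖ * ‖ε‖) * (t - 1) := by
  have hπI : Integrable π := by
    by_contra h
    rw [integral_undef h] at hπ_int
    exact zero_ne_one hπ_int
  have ht0 : 0 < t := by linarith
  have hl : 0 ≤ l := (abs_nonneg _).trans (hL_bdd 0)
  have hInn : 0 ≤ ∫ ε, ‖gradient π ε‖ * ‖ε‖ := integral_nonneg fun _ => by positivity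
  have hLm : AEStronglyMeasurable (fun ε => L (z + σ • ε)) volume :=
    (hL_meas.comp (by fun_prop)).aestronglyMeasurable
  have hpt : Integrable (fun η => t ^ n * π (t • η)) := (hπI.comp_smul ht0.ne').const_mul _
  have e1 : (∫ ε, L (t • z + σ • ε) * π ε) = ∫ η, L (z + σ • η) * (t ^ n * π (t • η)) := by
    have h := Measure.integral_comp_smul volume (fun ε => L (t • z + σ • ε) * π ε) t
    have hp : 0 < t ^ n := by positivity
    simp only [finrank_euclideanSpace, Fintype.card_fin, smul_eq_mul, abs_inv, abs_of_pos hp] at h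
    have h' : (∫ ε, L (t • z + σ • ε) * π ε) =
        t ^ n * ∫ η, L (t • z + σ • t • η) * π (t • η) := by
      rw [h]; field_simp
    rw [h', ← integral_const_mul]
    congr 1; ext η
    rw [smul_comm σ t η, ← smul_add, hL_sf t ht0]; ring
  have i1 : Integrable (fun η => L (z + σ • η) * (t ^ n * π (t • η))) :=
    hpt.bdd_mul hLm (Eventually.of_forall fun η => hL_bdd _)
  have i2 : Integrable (fun η => L (z + σ • η) * π η) :=
    hπI.bdd_mul hLm (Eventually.of_forall fun η => hL_bdd _)
  rw [e1, ← integral_sub i1 i2]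
  have hL1 : ∫ η, ‖t ^ n * π (t • η) - π η‖ ≤ (n + ∫ ε, ‖gradient π ε‖ * ‖ε‖) * (t - 1) := by
    rw [integral_norm_eq_lintegral_enorm (f := fun η => t ^ n * π (t • η) - π η)
      (hpt.sub hπI).aestronglyMeasurable]
    refine ENNReal.toReal_le_of_le_ofReal ?_ (aux_L1 π hπ_cd hπ_nn hπ_int hI t ht)
    exact mul_nonneg (by positivity) (by linarith)
  rw [← Real.norm_eq_abs]
  calc _ ≤ ∫ η, l * ‖t ^ n * π (t • η) - π η‖ := by
        refine norm_integral_le_of_norm_le ((hpt.sub hπI).norm.const_mul l)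
          (Eventually.of_forall fun η => ?_)
        rw [← mul_sub, norm_mul]
        gcongr
        exact hL_bdd _
    _ = l * ∫ η, ‖t ^ n * π (t • η) - π η‖ := integral_const_mul _ _
    _ ≤ l * ((n + ∫ ε, ‖gradient π ε‖ * ‖ε‖) * (t - 1)) := by gcongr
    _ = _ := by ring

/-- for a bounded scale-free loss smoothed by a well-behaved density,
|⟨∇_z L^π(z,σ), z⟩| ≤ l (n + I) uniformly in z and σ > 0. -/
theorem stmt_9 (n : ℕ) (hn : 0 < n)
    (L : EuclideanSpace ℝ (Fin n) → ℝ) (hL_meas : Measurable L)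
    (l : ℝ) (hL_bdd : ∀ z, |L z| ≤ l)
    (hL_sf : ∀ lam : ℝ, 0 < lam → ∀ z, L (lam • z) = L z)
    (π : EuclideanSpace ℝ (Fin n) → ℝ) (hπ_cd : ContDiff ℝ 1 π)
    (hπ_nn : ∀ ε, 0 ≤ π ε) (hπ_int : ∫ ε, π ε = 1)
    (C₀ : ℝ) (hgrad_bdd : ∀ ε, ‖gradient π ε‖ ≤ C₀)
    (C : ℝ) (hC : 0 < C)
    (hdecay : ∀ ε : EuclideanSpace ℝ (Fin n), 1 ≤ ‖ε‖ →
      ‖gradient π ε‖ ≤ C * ‖ε‖ ^ (-(n : ℝ) - 2))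
    (hLπ_cd : ContDiffOn ℝ 1
      (fun p : EuclideanSpace ℝ (Fin n) × ℝ => ∫ ε, L (p.1 + p.2 • ε) * π ε)
      (Set.univ ×ˢ Set.Ioi (0 : ℝ))) :
    ∀ (z : EuclideanSpace ℝ (Fin n)) (σ : ℝ), 0 < σ →
      |⟪gradient (fun y => ∫ ε, L (y + σ • ε) * π ε) z, z⟫| ≤
        l * (n + ∫ ε, ‖gradient π ε‖ * ‖ε‖) := by
  intro z σ _
  have hI := aux_integrable π hπ_cd C₀ hgrad_bdd C hC hdecay
  have hl : 0 ≤ l := (abs_nonneg _).trans (hL_bdd 0)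
  have hInn : 0 ≤ ∫ ε, ‖gradient π ε‖ * ‖ε‖ := integral_nonneg fun _ => by positivity
  by_cases hdiff : DifferentiableAt ℝ (fun y => ∫ ε, L (y + σ • ε) * π ε) z
  swap
  · rw [gradient_eq_zero_of_not_differentiableAt hdiff]
    simp only [inner_zero_left, abs_zero]
    positivity
  have h1 : HasDerivAt (fun s : ℝ => s • z) z 1 := by
    simpa using (hasDerivAt_id (1 : ℝ)).smul_const z
  have hz : HasFDerivAt (fun y => ∫ ε, L (y + σ • ε) * π ε)
      (fderiv ℝ (fun y => ∫ ε, L (y + σ • ε) * π ε) z) ((1 : ℝ) • z) := by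
    rw [one_smul]; exact hdiff.hasFDerivAt
  have h2 := hz.comp_hasDerivAt (1 : ℝ) h1
  have h3 : ⟪gradient (fun y => ∫ ε, L (y + σ • ε) * π ε) z, z⟫ =
      fderiv ℝ (fun y => ∫ ε, L (y + σ • ε) * π ε) z z := by
    simp [gradient]
  rw [h3]
  have h4 := hasDerivWithinAt_iff_tendsto_slope.1 (h2.hasDerivWithinAt (s := Set.Ioi 1))
  rw [show Set.Ioi (1 : ℝ) \ {1} = Set.Ioi 1 by simp] at h4
  refine le_of_tendsto h4.abs ?_
  filter_upwards [self_mem_nhdsWithin] with t ht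
  have ht' : (1 : ℝ) < t := ht
  have hm := aux_main L hL_meas l hL_bdd hL_sf π hπ_cd hπ_nn hπ_int hI z σ t ht'.le
  rw [slope_def_field, abs_div, abs_of_pos (sub_pos.2 ht'), div_le_iff₀ (sub_pos.2 ht')]
  simpa using hm
end

section
/- Let G : ℝ^n × (0, ∞) → ℝ be continuously differentiable and satisfy the PDE ∂G/∂σ (z, σ) = −σ^{−1} ⟨∇_z G(z, σ), z⟩ for all z ∈ ℝ^n, σ > 0. Let s : ℝ^n → (0, ∞) be differentiable. Then the function z ↦ G(z, s(z)) is differentiable and its gradient equals ∇_z[G(z, s(z))] = (∇_z G)(z, s(z)) − ⟨(∇_z G)(z, s(z)), z⟩ · ∇ log s(z). -/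
open MeasureTheory Filter RealInnerProductSpace

/-- Appendix Lemma on Scale-Free Acceleration: composing a C¹ function
satisfying ∂_σ G = −σ⁻¹⟨∇_z G, z⟩ with a z-dependent positive differentiable scale s(z)
changes the gradient by a correction along ∇ log s(z). -/
theorem stmt_10 (n : ℕ) (G : EuclideanSpace ℝ (Fin n) → ℝ → ℝ)
    (hG : ContDiffOn ℝ 1 (fun p : EuclideanSpace ℝ (Fin n) × ℝ => G p.1 p.2)
      (Set.univ ×ˢ Set.Ioi (0 : ℝ)))
    (hPDE : ∀ (z : EuclideanSpace ℝ (Fin n)) (σ : ℝ), 0 < σ →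
      deriv (G z) σ = -σ⁻¹ * ⟪gradient (fun y => G y σ) z, z⟫)
    (s : EuclideanSpace ℝ (Fin n) → ℝ) (hs_pos : ∀ z, 0 < s z)
    (hs_diff : Differentiable ℝ s) :
    ∀ z : EuclideanSpace ℝ (Fin n),
      DifferentiableAt ℝ (fun y => G y (s y)) z ∧
      gradient (fun y => G y (s y)) z =
        gradient (fun y => G y (s z)) z -
          ⟪gradient (fun y => G y (s z)) z, z⟫ •
            gradient (fun y => Real.log (s y)) z := by
  intro z
  have hsz := hs_pos z
  have hF : DifferentiableAt ℝ (fun p : EuclideanSpace ℝ (Fin n) × ℝ => G p.1 p.2) (z, s z) := by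
    have hmem : (Set.univ ×ˢ Set.Ioi (0 : ℝ) : Set (EuclideanSpace ℝ (Fin n) × ℝ))
        ∈ nhds (z, s z) :=
      (isOpen_univ.prod isOpen_Ioi).mem_nhds ⟨Set.mem_univ _, hsz⟩
    exact (hG.contDiffAt hmem).differentiableAt (by norm_num)
  obtain ⟨L, hL⟩ := hF
  have hs := (hs_diff z).hasFDerivAt
  have h1 : HasFDerivAt (fun y => G y (s y))
      (L.comp ((ContinuousLinearMap.id ℝ _).prod (fderiv ℝ s z))) z :=
    HasFDerivAt.comp (f := fun y => (y, s y)) z hL ((hasFDerivAt_id z).prodMk hs)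
  have h2 : HasFDerivAt (fun y => G y (s z))
      (L.comp ((ContinuousLinearMap.id ℝ _).prod 0)) z :=
    HasFDerivAt.comp (f := fun y => (y, s z)) z hL
      ((hasFDerivAt_id z).prodMk (hasFDerivAt_const (s z) z))
  have h3 : HasDerivAt (G z) (L (0, 1)) (s z) :=
    HasFDerivAt.comp_hasDerivAt (f := fun t => (z, t)) (s z) hL
      ((hasDerivAt_const (s z) z).prodMk (hasDerivAt_id (s z)))
  have h4 : HasFDerivAt (fun y => Real.log (s y)) ((s z)⁻¹ • fderiv ℝ s z) z :=
    hs.log hsz.ne'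
  have hP := hPDE z (s z) hsz
  rw [h3.deriv] at hP
  refine ⟨h1.differentiableAt, ?_⟩
  generalize hc : ⟪gradient (fun y => G y (s z)) z, z⟫ = c at hP ⊢
  unfold gradient
  rw [h1.fderiv, h2.fderiv, h4.fderiv, ← LinearIsometryEquiv.map_smul, ← map_sub]
  congr 1
  ext v
  have hv : L (v, fderiv ℝ s z v) = L (v, 0) + fderiv ℝ s z v * L (0, 1) := by
    rw [← smul_eq_mul, ← map_smul, ← map_add]
    simp
  simp [hv, hP]
  ring
end

section
/- Let G : ℝ^n × (0, ∞) → ℝ be continuously differentiable and satisfy ∂G/∂σ (z, σ) = −σ^{−1} ⟨∇_z G(z, σ), z⟩ for all z, σ. Fix σ₀ > 0 and z' ∈ ℝ^n with z' ≠ 0, and define ŝ(z) = (‖z‖₂/‖z'‖₂)·σ₀ for z ≠ 0. Then the gradient of z ↦ G(z, ŝ(z)) evaluated at z = z' equals ∇_z[G(z, ŝ(z))]|_{z=z'} = (∇_z G)(z', σ₀) − ⟨(∇_z G)(z', σ₀), z'/‖z'‖₂⟩ · z'/‖z'‖₂, i.e. the orthogonal projection of (∇_z G)(z', σ₀) onto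 the hyperplane orthogonal to z'. -/
open MeasureTheory Filter RealInnerProductSpace

/-- Theorem 4 of the paper: for the Scale-Free Acceleration smoothing scale
ŝ(z) = (‖z‖/‖z'‖)σ₀, the gradient of z ↦ G(z, ŝ(z)) at z = z' is the orthogonal projection
of ∇_z G(z', σ₀) onto the hyperplane orthogonal to z'. -/
theorem stmt_11 (n : ℕ) (G : EuclideanSpace ℝ (Fin n) → ℝ → ℝ)
    (hG : ContDiffOn ℝ 1 (fun p : EuclideanSpace ℝ (Fin n) × ℝ => G p.1 p.2)
      (Set.univ ×ˢ Set.Ioi (0 : ℝ)))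
    (hPDE : ∀ (z : EuclideanSpace ℝ (Fin n)) (σ : ℝ), 0 < σ →
      deriv (G z) σ = -σ⁻¹ * ⟪gradient (fun y => G y σ) z, z⟫)
    (σ₀ : ℝ) (hσ₀ : 0 < σ₀) (z' : EuclideanSpace ℝ (Fin n)) (hz' : z' ≠ 0) :
    gradient (fun z => G z (‖z‖ / ‖z'‖ * σ₀)) z' =
      gradient (fun y => G y σ₀) z' -
        ⟪gradient (fun y => G y σ₀) z', ‖z'‖⁻¹ • z'⟫ • (‖z'‖⁻¹ • z') := by
  have hn : ‖z'‖ ≠ 0 := norm_ne_zero_iff.mpr hz'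
  have hdiff : DifferentiableAt ℝ (fun p : EuclideanSpace ℝ (Fin n) × ℝ => G p.1 p.2) (z', σ₀) := by
    refine (hG.contDiffAt ?_).differentiableAt (by norm_num)
    exact (isOpen_univ.prod isOpen_Ioi).mem_nhds ⟨Set.mem_univ _, hσ₀⟩
  obtain ⟨L, hL⟩ := hdiff
  have h1 : HasFDerivAt (fun y => G y σ₀)
      (L.comp ((ContinuousLinearMap.id ℝ (EuclideanSpace ℝ (Fin n))).prod 0)) z' :=
    HasFDerivAt.comp (f := fun y : EuclideanSpace ℝ (Fin n) => (y, σ₀)) z' hL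
      ((hasFDerivAt_id z').prodMk (hasFDerivAt_const σ₀ z'))
  have h2 : HasDerivAt (G z') (L (0, 1)) σ₀ :=
    HasFDerivAt.comp_hasDerivAt (f := fun s : ℝ => (z', s)) σ₀ hL
      ((hasDerivAt_const σ₀ z').prodMk (hasDerivAt_id σ₀))
  have hg : ∀ v, ⟪gradient (fun y => G y σ₀) z', v⟫ = L (v, 0) := by
    intro v
    rw [gradient, h1.fderiv, InnerProductSpace.toDual_symm_apply]
    simp
  have hp := hPDE z' σ₀ hσ₀
  rw [h2.deriv] at hp
  have hnorm : HasFDerivAt (fun z : EuclideanSpace ℝ (Fin n) => ‖z‖)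
      (‖z'‖⁻¹ • innerSL ℝ z') z' := by
    have h := ((hasStrictFDerivAt_norm_sq z').hasFDerivAt).sqrt (pow_ne_zero 2 hn)
    simp only [Real.sqrt_sq (norm_nonneg _)] at h
    have e : (1 / (2 * ‖z'‖)) • 2 • (innerSL ℝ) z' = ‖z'‖⁻¹ • innerSL ℝ z' := by
      rw [← Nat.cast_smul_eq_nsmul ℝ, smul_smul]
      congr 1
      push_cast
      field_simp
    exact e ▸ h
  have hs : HasFDerivAt (fun z : EuclideanSpace ℝ (Fin n) => ‖z‖ / ‖z'‖ * σ₀)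
      ((σ₀ / ‖z'‖) • (‖z'‖⁻¹ • innerSL ℝ z')) z' := by
    have e : (fun z : EuclideanSpace ℝ (Fin n) => ‖z‖ / ‖z'‖ * σ₀) =
        fun z => σ₀ / ‖z'‖ * ‖z‖ := by
      funext z
      ring
    rw [e]
    exact hnorm.const_mul (σ₀ / ‖z'‖)
  have hL' : HasFDerivAt (fun p : EuclideanSpace ℝ (Fin n) × ℝ => G p.1 p.2) L
      (z', ‖z'‖ / ‖z'‖ * σ₀) := by
    rwa [div_self hn, one_mul]
  have h3 : HasFDerivAt (fun z => G z (‖z‖ / ‖z'‖ * σ₀)) _ z' :=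
    HasFDerivAt.comp (f := fun z : EuclideanSpace ℝ (Fin n) => (z, ‖z‖ / ‖z'‖ * σ₀)) z' hL'
      ((hasFDerivAt_id z').prodMk hs)
  refine ext_inner_right ℝ fun v => ?_
  rw [inner_sub_left, hg, gradient, h3.fderiv, InnerProductSpace.toDual_symm_apply]
  have hsplit : ∀ c : ℝ, L (v, c) = L (v, 0) + c * L (0, 1) := by
    intro c
    rw [← smul_eq_mul, ← map_smul, ← map_add]
    simp
  simp only [ContinuousLinearMap.comp_apply, ContinuousLinearMap.prod_apply,
    ContinuousLinearMap.id_apply, ContinuousLinearMap.smul_apply, innerSL_apply_apply, smul_eq_mul,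
    inner_smul_left, inner_smul_right]
  rw [hsplit, hp]
  simp
  field_simp
  ring
end

section
/- Let n ≥ 1, v, z ∈ ℝ^n with z ≠ 0, ν > 0, and C ≥ 0 with |⟨v, z⟩| ≤ C. Then ‖⟨v, z/(‖z‖₂ + ν)⟩ · z/(‖z‖₂ + ν) − ⟨v, z/‖z‖₂⟩ · z/‖z‖₂‖₂ ≤ 2Cν / (‖z‖₂ (‖z‖₂ + ν)). In particular, for fixed ν the difference tends to 0 as ‖z‖₂ → ∞. -/
open RealInnerProductSpace

lemma sfa_bias_aux {n : ℕ} (v z : EuclideanSpace ℝ (Fin n)) (hz : z ≠ 0)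
    (ν : ℝ) (hν : 0 < ν) (C : ℝ) (hvz : |⟪v, z⟫| ≤ C) :
    ‖⟪v, (‖z‖ + ν)⁻¹ • z⟫ • ((‖z‖ + ν)⁻¹ • z) - ⟪v, ‖z‖⁻¹ • z⟫ • (‖z‖⁻¹ • z)‖ ≤
      2 * C * ν / (‖z‖ * (‖z‖ + ν)) := by
  have hr : 0 < ‖z‖ := norm_pos_iff.mpr hz
  have e : ⟪v, (‖z‖ + ν)⁻¹ • z⟫ • ((‖z‖ + ν)⁻¹ • z) - ⟪v, ‖z‖⁻¹ • z⟫ • (‖z‖⁻¹ • z)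
      = (-(⟪v, z⟫ * (ν * (2 * ‖z‖ + ν) / (‖z‖ ^ 2 * (‖z‖ + ν) ^ 2)))) • z := by
    rw [real_inner_smul_right, real_inner_smul_right, smul_smul, smul_smul, ← sub_smul]
    congr 1
    have : ‖z‖ + ν ≠ 0 := by positivity
    field_simp
    ring
  rw [e, norm_smul, norm_neg, norm_mul, Real.norm_eq_abs, Real.norm_eq_abs]
  generalize ‖z‖ = r at *
  have hk : 0 ≤ ν * (2 * r + ν) / (r ^ 2 * (r + ν) ^ 2) := by positivity
  rw [abs_of_nonneg hk]
  have hC : 0 ≤ C := (abs_nonneg _).trans hvz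
  calc _ ≤ C * (ν * (2 * r + ν) / (r ^ 2 * (r + ν) ^ 2)) * r := by gcongr
    _ = C * ν * (2 * r + ν) / (r * (r + ν) ^ 2) := by field_simp
    _ ≤ C * ν * (2 * (r + ν)) / (r * (r + ν) ^ 2) := by gcongr; linarith
    _ = _ := by field_simp

/-- the deterministic core of the SFA bias lemma — replacing the exact
orthogonal projection against z by the ν-regularized one introduces a bias bounded by
2Cν/(‖z‖(‖z‖+ν)), which tends to 0 as ‖z‖ → ∞. -/
theorem stmt_12 (n : ℕ) (hn : 1 ≤ n) (v z : EuclideanSpace ℝ (Fin n)) (hz : z ≠ 0)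
    (ν : ℝ) (hν : 0 < ν) (C : ℝ) (hC : 0 ≤ C) (hvz : |⟪v, z⟫| ≤ C) :
    ‖⟪v, (‖z‖ + ν)⁻¹ • z⟫ • ((‖z‖ + ν)⁻¹ • z) - ⟪v, ‖z‖⁻¹ • z⟫ • (‖z‖⁻¹ • z)‖ ≤
      2 * C * ν / (‖z‖ * (‖z‖ + ν)) ∧
    ∀ δ > (0 : ℝ), ∃ R : ℝ, ∀ (z' v' : EuclideanSpace ℝ (Fin n)), z' ≠ 0 → R ≤ ‖z'‖ →
      |⟪v', z'⟫| ≤ C →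
      ‖⟪v', (‖z'‖ + ν)⁻¹ • z'⟫ • ((‖z'‖ + ν)⁻¹ • z') -
          ⟪v', ‖z'‖⁻¹ • z'⟫ • (‖z'‖⁻¹ • z')‖ ≤ δ := by
  refine ⟨sfa_bias_aux v z hz ν hν C hvz, fun δ hδ => ⟨2 * C / δ, fun z' v' hz' hR h => ?_⟩⟩
  refine (sfa_bias_aux v' z' hz' ν hν C h).trans ?_
  have hr : 0 < ‖z'‖ := norm_pos_iff.mpr hz'
  rw [div_le_iff₀ hδ] at hR
  rw [div_le_iff₀ (by positivity)]
  have h1 : 2 * C * ν ≤ ‖z'‖ * δ * ν := by gcongr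
  have h2 : 0 ≤ δ * ‖z'‖ * ‖z'‖ := by positivity
  nlinarith
end

section
/- Let d be a positive integer, φ : ℝ^d × (0, ∞) → ℝ a measurable function satisfying φ(λF, λσ) = φ(F, σ) for all λ > 0, F ∈ ℝ^d, σ > 0, let Γ ∈ ℝ^{d×d}, and let β, γ, σ > 0. Suppose the normalizing constants Z = ∫_{ℝ^d} exp(−β(φ(F, σ) + (γ/2)‖ΓF‖₂²)) dF and Z' = ∫_{ℝ^d} exp(−β(φ(F, 1) + (σ²γ/2)‖ΓF‖₂²)) dF are finite and positive. Then for every bounded measurable g : ℝ^d → ℝ with g(λF) = g(F) for all λ > 0: Z^{−1} ∫ g(F) exp(−β(φ(F, σ) + (γ/2)‖ΓF‖₂²)) dF = Z'^{−1} ∫ g(F) exp(−β(φ(F, 1) + (σ²γ/2)‖ΓF‖₂²)) dF. -/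
open MeasureTheory Real

/-- for the Gibbs distribution of a jointly degree-0 homogeneous smoothed
loss plus a Gaussian regularizer, the expected value of any bounded scale-free function is
the same under parameters (σ, γ) and (1, σ²γ). -/
theorem stmt_15 (d : ℕ) (hd : 0 < d)
    (φ : (Fin d → ℝ) → ℝ → ℝ)
    (hφ_meas : Measurable fun p : (Fin d → ℝ) × ℝ => φ p.1 p.2)
    (hφ_hom : ∀ lam : ℝ, 0 < lam → ∀ (F : Fin d → ℝ) (σ : ℝ), 0 < σ →
      φ (lam • F) (lam * σ) = φ F σ)
    (Γ : Matrix (Fin d) (Fin d) ℝ) (β γ σ : ℝ) (hβ : 0 < β) (hγ : 0 < γ) (hσ : 0 < σ)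
    (hZ_int : Integrable (fun F : Fin d → ℝ =>
      Real.exp (-β * (φ F σ + γ / 2 * ∑ i, Γ.mulVec F i ^ 2))))
    (hZ_pos : 0 < ∫ F : Fin d → ℝ,
      Real.exp (-β * (φ F σ + γ / 2 * ∑ i, Γ.mulVec F i ^ 2)))
    (hZ'_int : Integrable (fun F : Fin d → ℝ =>
      Real.exp (-β * (φ F 1 + σ ^ 2 * γ / 2 * ∑ i, Γ.mulVec F i ^ 2))))
    (hZ'_pos : 0 < ∫ F : Fin d → ℝ,
      Real.exp (-β * (φ F 1 + σ ^ 2 * γ / 2 * ∑ i, Γ.mulVec F i ^ 2))) :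
    ∀ g : (Fin d → ℝ) → ℝ, Measurable g → (∃ Cg : ℝ, ∀ F, |g F| ≤ Cg) →
      (∀ lam : ℝ, 0 < lam → ∀ F, g (lam • F) = g F) →
      (∫ F : Fin d → ℝ, Real.exp (-β * (φ F σ + γ / 2 * ∑ i, Γ.mulVec F i ^ 2)))⁻¹ *
          ∫ F : Fin d → ℝ,
            g F * Real.exp (-β * (φ F σ + γ / 2 * ∑ i, Γ.mulVec F i ^ 2)) =
        (∫ F : Fin d → ℝ,
            Real.exp (-β * (φ F 1 + σ ^ 2 * γ / 2 * ∑ i, Γ.mulVec F i ^ 2)))⁻¹ *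
          ∫ F : Fin d → ℝ,
            g F * Real.exp (-β * (φ F 1 + σ ^ 2 * γ / 2 * ∑ i, Γ.mulVec F i ^ 2)) := by
  intro g _ _ hg
  have key : ∀ F : Fin d → ℝ,
      Real.exp (-β * (φ F 1 + σ ^ 2 * γ / 2 * ∑ i, Γ.mulVec F i ^ 2)) =
        (fun F : Fin d → ℝ =>
          Real.exp (-β * (φ F σ + γ / 2 * ∑ i, Γ.mulVec F i ^ 2))) (σ • F) := by
    intro F
    have h1 : φ (σ • F) σ = φ F 1 := by
      have h := hφ_hom σ hσ F 1 one_pos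
      rwa [mul_one] at h
    have h2 : ∑ i, Γ.mulVec (σ • F) i ^ 2 = σ ^ 2 * ∑ i, Γ.mulVec F i ^ 2 := by
      rw [Finset.mul_sum]
      refine Finset.sum_congr rfl fun i _ => ?_
      rw [Matrix.mulVec_smul, Pi.smul_apply, smul_eq_mul, mul_pow]
    simp only [h1, h2]
    congr 1
    ring
  have keyg : ∀ F : Fin d → ℝ,
      g F * Real.exp (-β * (φ F 1 + σ ^ 2 * γ / 2 * ∑ i, Γ.mulVec F i ^ 2)) =
        (fun F : Fin d → ℝ =>
          g F * Real.exp (-β * (φ F σ + γ / 2 * ∑ i, Γ.mulVec F i ^ 2))) (σ • F) := by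
    intro F
    rw [key F]
    simp only [hg σ hσ F]
  have e1 := (integral_congr_ae (μ := volume) (Filter.Eventually.of_forall key)).trans
    (Measure.integral_comp_smul volume (fun F : Fin d → ℝ =>
          Real.exp (-β * (φ F σ + γ / 2 * ∑ i, Γ.mulVec F i ^ 2))) σ)
  have e2 := (integral_congr_ae (μ := volume) (Filter.Eventually.of_forall keyg)).trans
    (Measure.integral_comp_smul volume (fun F : Fin d → ℝ =>
          g F * Real.exp (-β * (φ F σ + γ / 2 * ∑ i, Γ.mulVec F i ^ 2))) σ)
  rw [e1, e2, smul_eq_mul, smul_eq_mul]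
  have hc : |(σ ^ Module.finrank ℝ (Fin d → ℝ))⁻¹| ≠ 0 :=
    abs_ne_zero.2 (inv_ne_zero (pow_ne_zero _ hσ.ne'))
  rw [mul_inv, mul_mul_mul_comm, inv_mul_cancel₀ hc, one_mul]
end

section
/- Let L : ℝ^n → ℝ be measurable with |L(z)| ≤ l for all z, let σ > 0, and define the smoothed loss L^π(z, σ) = ∫_{ℝ^n} L(z + σε) π(ε) dε. (a) If π is a continuously differentiable probability density on ℝ^n with I₁ := ∫ ‖∇π(ε)‖₂ dε < ∞, then z ↦ L^π(z, σ) is Lipschitz continuous with Lipschitz constant at most l·I₁/σ. (b) If moreover π is twice continuously differentiable with I₂ := ∫ ‖∇²π(ε)‖_op dε < ∞, then z ↦ ∇_z L^π(z, σ) is Lipschitz continuous with Lipschitz constant at most l·I₂/σ². -/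
open MeasureTheory

section helpers

variable {n : ℕ} {V : Type*} [NormedAddCommGroup V] [NormedSpace ℝ V] [CompleteSpace V]

/-- A curve moves at most the integral of its speed. -/
lemma aux_curve (φ φ' : ℝ → V) (hd : ∀ t, HasDerivAt φ (φ' t) t) (hc : Continuous φ') :
    ‖φ 1 - φ 0‖ₑ ≤ ∫⁻ t in Set.Ioc (0:ℝ) 1, ‖φ' t‖ₑ := by
  have h := intervalIntegral.integral_eq_sub_of_hasDerivAt (a := 0) (b := 1)
    (fun x _ => hd x) (hc.intervalIntegrable 0 1)
  rw [← h, intervalIntegral.integral_of_le zero_le_one]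
  exact enorm_integral_le_lintegral_enorm _

lemma aux_conv {f : EuclideanSpace ℝ (Fin n) → V} (hf : Continuous f) {c : ℝ} (hc : 0 ≤ c)
    (h : ∫⁻ x, ‖f x‖ₑ ≤ ENNReal.ofReal c) : Integrable f ∧ ∫ x, ‖f x‖ ≤ c := by
  have hm : AEStronglyMeasurable f volume := hf.aestronglyMeasurable
  refine ⟨⟨hm, lt_of_le_of_lt h ENNReal.ofReal_lt_top⟩, ?_⟩
  rw [integral_norm_eq_lintegral_enorm hm]
  exact ENNReal.toReal_le_of_le_ofReal hc h

lemma aux_trans {g : EuclideanSpace ℝ (Fin n) → V} (hg : ContDiff ℝ 1 g)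
    (h : EuclideanSpace ℝ (Fin n)) :
    ∫⁻ x, ‖g (x + h) - g x‖ₑ ≤ (∫⁻ x, ‖fderiv ℝ g x‖ₑ) * ‖h‖ₑ := by
  have hcd : Continuous (fderiv ℝ g) := hg.continuous_fderiv (by norm_num)
  have hpt : ∀ x, ‖g (x + h) - g x‖ₑ ≤
      ∫⁻ t in Set.Ioc (0:ℝ) 1, ‖fderiv ℝ g (x + t • h)‖ₑ * ‖h‖ₑ := by
    intro x
    have := aux_curve (fun t : ℝ => g (x + t • h)) (fun t => fderiv ℝ g (x + t • h) h) ?_ ?_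
    · simp only [one_smul, zero_smul, add_zero] at this
      exact this.trans (lintegral_mono fun t => ContinuousLinearMap.le_opENorm _ _)
    · intro t
      have h1 : HasDerivAt (fun t : ℝ => x + t • h) h t := by
        simpa using ((hasDerivAt_id t).smul_const h).const_add x
      exact ((hg.differentiable (by norm_num)) (x + t • h)).hasFDerivAt.comp_hasDerivAt t h1
    · fun_prop
  calc ∫⁻ x, ‖g (x + h) - g x‖ₑ
      ≤ ∫⁻ x, ∫⁻ t in Set.Ioc (0:ℝ) 1, ‖fderiv ℝ g (x + t • h)‖ₑ * ‖h‖ₑ := lintegral_mono hpt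
    _ = ∫⁻ t in Set.Ioc (0:ℝ) 1, ∫⁻ x, ‖fderiv ℝ g (x + t • h)‖ₑ * ‖h‖ₑ := by
        apply lintegral_lintegral_swap
        apply Measurable.aemeasurable
        simp only [Function.uncurry_def]
        apply Measurable.mul_const
        apply Continuous.measurable
        fun_prop
    _ = ∫⁻ t in Set.Ioc (0:ℝ) 1, (∫⁻ x, ‖fderiv ℝ g x‖ₑ) * ‖h‖ₑ := by
        congr 1; ext t
        rw [lintegral_mul_const' _ _ enorm_ne_top,
          lintegral_add_right_eq_self (fun x => ‖fderiv ℝ g x‖ₑ)]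
    _ = _ := by simp

lemma aux_trans_real {g : EuclideanSpace ℝ (Fin n) → V} (hg : ContDiff ℝ 1 g)
    (hi : Integrable (fun x => ‖fderiv ℝ g x‖)) (h : EuclideanSpace ℝ (Fin n)) :
    Integrable (fun x => g (x + h) - g x) ∧
    ∫ x, ‖g (x + h) - g x‖ ≤ (∫ x, ‖fderiv ℝ g x‖) * ‖h‖ := by
  have hgc := hg.continuous
  refine aux_conv (by fun_prop) (by positivity) ((aux_trans hg h).trans (le_of_eq ?_))
  rw [ENNReal.ofReal_mul (by positivity), ofReal_integral_eq_lintegral_ofReal hi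
    (Filter.Eventually.of_forall fun x => norm_nonneg _)]
  simp only [ofReal_norm]

/-- Second order remainder in L¹. -/
lemma aux_taylor {p : EuclideanSpace ℝ (Fin n) → ℝ}
    {g : EuclideanSpace ℝ (Fin n) → EuclideanSpace ℝ (Fin n)}
    (hp : ∀ x, HasGradientAt p (g x) x) (hg : ContDiff ℝ 1 g)
    (hi : Integrable (fun x => ‖fderiv ℝ g x‖)) (h : EuclideanSpace ℝ (Fin n)) :
    Integrable (fun x => p (x + h) - p x - inner ℝ (g x) h) ∧
    ∫ x, ‖p (x + h) - p x - inner ℝ (g x) h‖ ≤ (∫ x, ‖fderiv ℝ g x‖) * ‖h‖ * ‖h‖ := by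
  have hgc := hg.continuous
  have hpc : Continuous p := continuous_iff_continuousAt.2 fun x => (hp x).continuousAt
  refine aux_conv (by fun_prop) (by positivity) ?_
  have hpt : ∀ x, ‖p (x + h) - p x - inner ℝ (g x) h‖ₑ ≤
      ∫⁻ t in Set.Ioc (0:ℝ) 1, ‖g (x + t • h) - g x‖ₑ * ‖h‖ₑ := by
    intro x
    have := aux_curve (fun t : ℝ => p (x + t • h) - t * inner ℝ (g x) h)
      (fun t => inner ℝ (g (x + t • h) - g x) h) ?_ ?_
    · simp only [one_smul, zero_smul, add_zero, one_mul, zero_mul, sub_zero] at this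
      rw [sub_right_comm]
      refine this.trans (lintegral_mono fun t => ?_)
      simp only [← ofReal_norm]
      rw [← ENNReal.ofReal_mul (norm_nonneg _)]
      exact ENNReal.ofReal_le_ofReal (norm_inner_le_norm _ _)
    · intro t
      have h1 : HasDerivAt (fun t : ℝ => x + t • h) h t := by
        simpa using ((hasDerivAt_id t).smul_const h).const_add x
      have h2 := (hp (x + t • h)).hasFDerivAt.comp_hasDerivAt t h1
      have h3 := h2.sub ((hasDerivAt_id t).mul_const (inner ℝ (g x) h))
      refine HasDerivAt.congr_deriv h3 ?_
      simp [inner_sub_left]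
    · fun_prop
  calc ∫⁻ x, ‖p (x + h) - p x - inner ℝ (g x) h‖ₑ
      ≤ ∫⁻ x, ∫⁻ t in Set.Ioc (0:ℝ) 1, ‖g (x + t • h) - g x‖ₑ * ‖h‖ₑ := lintegral_mono hpt
    _ = ∫⁻ t in Set.Ioc (0:ℝ) 1, ∫⁻ x, ‖g (x + t • h) - g x‖ₑ * ‖h‖ₑ := by
        apply lintegral_lintegral_swap
        apply Measurable.aemeasurable
        simp only [Function.uncurry_def]
        apply Measurable.mul_const
        apply Continuous.measurable
        fun_prop
    _ ≤ ∫⁻ t in Set.Ioc (0:ℝ) 1, (∫⁻ x, ‖fderiv ℝ g x‖ₑ) * ‖h‖ₑ * ‖h‖ₑ := by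
        refine setLIntegral_mono' measurableSet_Ioc fun t ht => ?_
        rw [lintegral_mul_const' _ _ enorm_ne_top]
        gcongr
        refine (aux_trans hg (t • h)).trans ?_
        gcongr
        simp only [← ofReal_norm]
        apply ENNReal.ofReal_le_ofReal
        rw [norm_smul, Real.norm_of_nonneg ht.1.le]
        exact mul_le_of_le_one_left (norm_nonneg _) ht.2
    _ = _ := by
        rw [ENNReal.ofReal_mul (by positivity), ENNReal.ofReal_mul (by positivity),
          ofReal_integral_eq_lintegral_ofReal hi
          (Filter.Eventually.of_forall fun x => norm_nonneg _)]
        simp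

lemma aux_bdd {L : EuclideanSpace ℝ (Fin n) → ℝ} (hL_meas : Measurable L)
    {l : ℝ} (hL_bdd : ∀ z, |L z| ≤ l) (σ : ℝ) (z : EuclideanSpace ℝ (Fin n))
    {f : EuclideanSpace ℝ (Fin n) → V} (hf : Integrable f) :
    Integrable (fun x => L (z + σ • x) • f x) ∧
    ‖∫ x, L (z + σ • x) • f x‖ ≤ l * ∫ x, ‖f x‖ := by
  have hm : Measurable (fun x => L (z + σ • x)) := hL_meas.comp (by fun_prop)
  refine ⟨hf.bdd_smul l hm.aestronglyMeasurable
    (Filter.Eventually.of_forall fun x => hL_bdd _), ?_⟩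
  rw [← integral_const_mul]
  refine norm_integral_le_of_norm_le (hf.norm.const_mul l)
    (Filter.Eventually.of_forall fun x => ?_)
  rw [norm_smul]
  exact mul_le_mul_of_nonneg_right (hL_bdd _) (norm_nonneg _)

lemma aux_shift (L : EuclideanSpace ℝ (Fin n) → ℝ) {σ : ℝ} (hσ : 0 < σ)
    (z₁ z₂ : EuclideanSpace ℝ (Fin n)) (g : EuclideanSpace ℝ (Fin n) → V) :
    ∫ x, L (z₁ + σ • x) • g x = ∫ x, L (z₂ + σ • x) • g (x + σ⁻¹ • (z₂ - z₁)) := by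
  rw [← integral_add_right_eq_self (fun x => L (z₁ + σ • x) • g x) (σ⁻¹ • (z₂ - z₁))]
  congr 1; ext x
  congr 2
  rw [smul_add, smul_inv_smul₀ hσ.ne']
  abel

lemma aux_lip {L : EuclideanSpace ℝ (Fin n) → ℝ} (hL_meas : Measurable L)
    {l : ℝ} (hL_bdd : ∀ z, |L z| ≤ l) {σ : ℝ} (hσ : 0 < σ)
    {g : EuclideanSpace ℝ (Fin n) → V} (hgi : Integrable g) (hg : ContDiff ℝ 1 g)
    (hi : Integrable (fun x => ‖fderiv ℝ g x‖)) (z₁ z₂ : EuclideanSpace ℝ (Fin n)) :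
    ‖(∫ x, L (z₁ + σ • x) • g x) - ∫ x, L (z₂ + σ • x) • g x‖ ≤
      l * (∫ x, ‖fderiv ℝ g x‖) / σ * ‖z₁ - z₂‖ := by
  have hl : 0 ≤ l := (abs_nonneg _).trans (hL_bdd 0)
  rw [aux_shift L hσ z₁ z₂, ← integral_sub
    (aux_bdd hL_meas hL_bdd σ z₂ (hgi.comp_add_right _)).1 (aux_bdd hL_meas hL_bdd σ z₂ hgi).1]
  simp only [← smul_sub]
  obtain ⟨h1, h2⟩ := aux_trans_real hg hi (σ⁻¹ • (z₂ - z₁))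
  refine (aux_bdd hL_meas hL_bdd σ z₂ h1).2.trans ?_
  refine (mul_le_mul_of_nonneg_left h2 hl).trans (le_of_eq ?_)
  rw [norm_smul, norm_sub_rev, Real.norm_of_nonneg (by positivity)]
  ring

lemma aux_grad_int {p : EuclideanSpace ℝ (Fin n) → ℝ}
    {g : EuclideanSpace ℝ (Fin n) → EuclideanSpace ℝ (Fin n)} (hpi : Integrable p)
    (hp : ∀ x, HasGradientAt p (g x) x) (hg : ContDiff ℝ 1 g)
    (hi : Integrable (fun x => ‖fderiv ℝ g x‖)) : Integrable g := by
  have key : ∀ h, Integrable (fun x => inner ℝ (g x) h) := by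
    intro h
    have := ((hpi.comp_add_right h).sub hpi).sub (aux_taylor hp hg hi h).1
    refine this.congr (Filter.Eventually.of_forall fun x => ?_)
    simp
  let b := EuclideanSpace.basisFun (Fin n) ℝ
  have : g = fun x => ∑ i, (inner ℝ (g x) (b i) : ℝ) • b i := by
    ext1 x
    conv_lhs => rw [← b.sum_repr' (g x)]
    simp only [real_inner_comm]
  rw [this]
  exact integrable_finsetSum _ fun i _ => (key (b i)).smul_const _

lemma aux_grad {L : EuclideanSpace ℝ (Fin n) → ℝ} (hL_meas : Measurable L)
    {l : ℝ} (hL_bdd : ∀ z, |L z| ≤ l) {σ : ℝ} (hσ : 0 < σ)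
    {p : EuclideanSpace ℝ (Fin n) → ℝ}
    {g : EuclideanSpace ℝ (Fin n) → EuclideanSpace ℝ (Fin n)} (hpi : Integrable p)
    (hp : ∀ x, HasGradientAt p (g x) x) (hg : ContDiff ℝ 1 g)
    (hi : Integrable (fun x => ‖fderiv ℝ g x‖)) (z : EuclideanSpace ℝ (Fin n)) :
    HasGradientAt (fun z => ∫ x, L (z + σ • x) * p x)
      (-σ⁻¹ • ∫ x, L (z + σ • x) • g x) z := by
  have hl : 0 ≤ l := (abs_nonneg _).trans (hL_bdd 0)
  have hgi := aux_grad_int hpi hp hg hi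
  rw [hasGradientAt_iff_isLittleO]
  refine Asymptotics.IsBigO.trans_isLittleO (g := fun w => ‖w - z‖ ^ 2) ?_ ?_
  · refine Asymptotics.IsBigO.of_bound (l * (∫ x, ‖fderiv ℝ g x‖) / σ ^ 2)
      (Filter.Eventually.of_forall fun w => ?_)
    have e1 := aux_shift L hσ w z p
    simp only [smul_eq_mul] at e1
    set h := σ⁻¹ • (z - w) with hh
    obtain ⟨t1, t2⟩ := aux_taylor hp hg hi h
    have i1 := (aux_bdd hL_meas hL_bdd σ z (hpi.comp_add_right h)).1
    have i2 := (aux_bdd hL_meas hL_bdd σ z hpi).1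
    have i3 := (aux_bdd hL_meas hL_bdd σ z hgi).1
    have i4 := (aux_bdd hL_meas hL_bdd σ z (hgi.inner_const (𝕜 := ℝ) h)).1
    simp only [smul_eq_mul] at i1 i2 i4
    have e2 : inner ℝ (-σ⁻¹ • ∫ x, L (z + σ • x) • g x) (w - z)
        = ∫ x, L (z + σ • x) * inner ℝ (g x) h := by
      have : inner ℝ (-σ⁻¹ • ∫ x, L (z + σ • x) • g x) (w - z)
        = inner ℝ h (∫ x, L (z + σ • x) • g x) := by
        rw [hh, real_inner_smul_left, real_inner_smul_left, ← neg_sub w z, inner_neg_left,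
          real_inner_comm]
        ring
      rw [this, ← integral_inner i3]
      congr 1; ext x
      rw [real_inner_smul_right, real_inner_comm]
    rw [e2, e1, ← integral_sub i1 i2, ← integral_sub (by exact i1.sub i2) i4]
    have e3 : (∫ x, (L (z + σ • x) * p (x + h) - L (z + σ • x) * p x
        - L (z + σ • x) * inner ℝ (g x) h))
        = ∫ x, L (z + σ • x) • (p (x + h) - p x - inner ℝ (g x) h) := by
      congr 1; ext x; simp only [smul_eq_mul]; ring
    rw [e3]
    refine (aux_bdd hL_meas hL_bdd σ z t1).2.trans ?_
    refine (mul_le_mul_of_nonneg_left t2 hl).trans (le_of_eq ?_)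
    rw [hh, norm_smul, norm_sub_rev, Real.norm_of_nonneg (by positivity : (0:ℝ) ≤ σ⁻¹)]
    simp only [norm_pow, norm_norm]
    ring
  · exact Asymptotics.isLittleO_pow_sub_sub z (by norm_num)

end helpers

/-- Appendix Lemma: the smoothed loss L^π(·, σ) is Lipschitz continuous
with constant l·I₁/σ, and its gradient is Lipschitz with constant l·I₂/σ², where
I₁ = ∫‖∇π‖ and I₂ = ∫‖∇²π‖_op. -/
theorem stmt_16 (n : ℕ)
    (L : EuclideanSpace ℝ (Fin n) → ℝ) (hL_meas : Measurable L)
    (l : ℝ) (hL_bdd : ∀ z, |L z| ≤ l) (σ : ℝ) (hσ : 0 < σ)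
    (π : EuclideanSpace ℝ (Fin n) → ℝ)
    (hπ_nn : ∀ ε, 0 ≤ π ε) (hπ_int : ∫ ε, π ε = 1) :
    (ContDiff ℝ 1 π → Integrable (fun ε => ‖gradient π ε‖) →
      ∀ z₁ z₂ : EuclideanSpace ℝ (Fin n),
        |(∫ ε, L (z₁ + σ • ε) * π ε) - ∫ ε, L (z₂ + σ • ε) * π ε| ≤
          l * (∫ ε, ‖gradient π ε‖) / σ * ‖z₁ - z₂‖) ∧
    (ContDiff ℝ 2 π → Integrable (fun ε => ‖fderiv ℝ (fun x => gradient π x) ε‖) →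
      ∀ z₁ z₂ : EuclideanSpace ℝ (Fin n),
        ‖gradient (fun z => ∫ ε, L (z + σ • ε) * π ε) z₁ -
            gradient (fun z => ∫ ε, L (z + σ • ε) * π ε) z₂‖ ≤
          l * (∫ ε, ‖fderiv ℝ (fun x => gradient π x) ε‖) / σ ^ 2 * ‖z₁ - z₂‖) := by
  have hpi : Integrable π := by
    by_contra h
    rw [integral_undef h] at hπ_int
    norm_num at hπ_int
  have hl : 0 ≤ l := (abs_nonneg _).trans (hL_bdd 0)
  constructor
  · intro hc hi z₁ z₂
    have hn : ∀ x, ‖gradient π x‖ = ‖fderiv ℝ π x‖ := fun x => by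
      simp [gradient]
    simp only [hn] at hi ⊢
    exact aux_lip hL_meas hL_bdd hσ hpi hc hi z₁ z₂
  · intro hc hi z₁ z₂
    have hp : ∀ x, HasGradientAt π (gradient π x) x := fun x =>
      ((hc.differentiable (by norm_num)) x).hasGradientAt
    have hg : ContDiff ℝ 1 (fun x => gradient π x) := by
      have : ContDiff ℝ 1 (fderiv ℝ π) := hc.fderiv_right (by norm_num)
      exact (InnerProductSpace.toDual ℝ
        (EuclideanSpace ℝ (Fin n))).symm.toContinuousLinearEquiv.contDiff.comp this
    have hgi := aux_grad_int hpi hp hg hi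
    rw [(aux_grad hL_meas hL_bdd hσ hpi hp hg hi z₁).gradient,
      (aux_grad hL_meas hL_bdd hσ hpi hp hg hi z₂).gradient, ← smul_sub, norm_smul]
    have := aux_lip hL_meas hL_bdd hσ hgi hg hi z₁ z₂
    rw [norm_neg, Real.norm_of_nonneg (by positivity : (0:ℝ) ≤ σ⁻¹)]
    refine (mul_le_mul_of_nonneg_left this (by positivity)).trans (le_of_eq ?_)
    ring
end

section
/- Let U_1, …, U_k be pairwise disjoint open subsets of ℝ^n whose union has a complement of Lebesgue measure zero, let c_1, …, c_k ∈ ℝ, and let L : ℝ^n → ℝ be a bounded measurable function with L ≡ c_i on U_i for each i. Fix z ∈ ℝ^n and a probability density π on ℝ^n, and suppose that for each i the limit α_i := lim_{σ→0⁺} ∫_{ℝ^n} 𝟙{z + σε ∈ U_i} π(ε) dε exists. Then ∑_{i=1}^k α_i = 1 and lim_{σ→0⁺} ∫_{ℝ^n} L(z + σε) π(ε) dε = ∑_{i=1}^k α_i c_i. -/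
open MeasureTheory Filter

/-- For positive scale, the smoothed value of a piecewise constant function is the weighted sum. -/
theorem smoothed_eq_sum (n : ℕ) (k : ℕ) (U : Fin k → Set (Fin n → ℝ))
    (hopen : ∀ i, IsOpen (U i))
    (hdisj : Pairwise fun i j => Disjoint (U i) (U j))
    (hnull : volume (⋃ i, U i)ᶜ = 0)
    (c : Fin k → ℝ) (L : (Fin n → ℝ) → ℝ)
    (hconst : ∀ i, ∀ z ∈ U i, L z = c i)
    (z : Fin n → ℝ) (π : (Fin n → ℝ) → ℝ) (hπ : Integrable π) (σ : ℝ) (hσ : 0 < σ) :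
    ∫ ε, L (z + σ • ε) * π ε =
      ∑ i, (∫ ε, Set.indicator (U i) (fun _ => (1 : ℝ)) (z + σ • ε) * π ε) * c i := by
  have hae : ∀ᵐ ε : Fin n → ℝ, z + σ • ε ∈ ⋃ i, U i := by
    rw [ae_iff]
    have h1 : volume ((fun x => z + x) ⁻¹' (⋃ i, U i)ᶜ) = 0 := by
      rw [measure_preimage_add, hnull]
    have h2 := Measure.addHaar_preimage_smul (volume : Measure (Fin n → ℝ)) hσ.ne'
      ((fun x => z + x) ⁻¹' (⋃ i, U i)ᶜ)
    rw [h1, mul_zero] at h2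
    exact h2
  have hint : ∀ i, Integrable
      (fun ε => Set.indicator (U i) (fun _ => (1 : ℝ)) (z + σ • ε) * π ε) := by
    intro i
    refine hπ.bdd_mul (c := 1) ?_ ?_
    · exact ((measurable_const.indicator (hopen i).measurableSet).comp
        (by fun_prop : Measurable fun ε : Fin n → ℝ => z + σ • ε)).aestronglyMeasurable
    · refine Eventually.of_forall fun ε => ?_
      by_cases h : z + σ • ε ∈ U i <;> simp [h]
  simp_rw [← integral_mul_const]
  rw [← integral_finsetSum _ fun i _ => (hint i).mul_const (c i)]
  refine integral_congr_ae ?_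
  filter_upwards [hae] with ε hε
  obtain ⟨j, hj⟩ := Set.mem_iUnion.1 hε
  rw [Finset.sum_eq_single j]
  · rw [hconst j _ hj, Set.indicator_of_mem hj]; ring
  · intro i _ hij
    have : z + σ • ε ∉ U i := fun h => Set.disjoint_left.1 (hdisj hij) h hj
    rw [Set.indicator_of_notMem this]; ring
  · simp

/-- the smoothing-bias decomposition — for a discrete loss taking constant
values c_i on disjoint open sets U_i covering the space up to a Lebesgue-null set, the
smoothed loss converges as σ → 0⁺ to the convex combination ∑ α_i c_i, where
α_i = lim_{σ→0⁺} P(z + σε ∈ U_i), and the weights sum to 1. -/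
theorem stmt_17 (n : ℕ) (k : ℕ) (U : Fin k → Set (Fin n → ℝ))
    (hopen : ∀ i, IsOpen (U i))
    (hdisj : Pairwise fun i j => Disjoint (U i) (U j))
    (hnull : volume (⋃ i, U i)ᶜ = 0)
    (c : Fin k → ℝ) (L : (Fin n → ℝ) → ℝ) (hL_meas : Measurable L)
    (l : ℝ) (hL_bdd : ∀ z, |L z| ≤ l)
    (hconst : ∀ i, ∀ z ∈ U i, L z = c i)
    (z : Fin n → ℝ) (π : (Fin n → ℝ) → ℝ) (hπ_meas : Measurable π)
    (hπ_nn : ∀ ε, 0 ≤ π ε) (hπ_int : ∫ ε, π ε = 1)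
    (α : Fin k → ℝ)
    (hα : ∀ i, Tendsto (fun σ : ℝ =>
        ∫ ε, Set.indicator (U i) (fun _ => (1 : ℝ)) (z + σ • ε) * π ε)
      (nhdsWithin 0 (Set.Ioi 0)) (nhds (α i))) :
    (∑ i, α i) = 1 ∧
    Tendsto (fun σ : ℝ => ∫ ε, L (z + σ • ε) * π ε)
      (nhdsWithin 0 (Set.Ioi 0)) (nhds (∑ i, α i * c i)) := by
  have hπ : Integrable π := by
    by_contra h
    rw [integral_undef h] at hπ_int
    exact zero_ne_one hπ_int
  have key : ∀ (d : Fin k → ℝ) (F : (Fin n → ℝ) → ℝ), (∀ i, ∀ z ∈ U i, F z = d i) →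
      Tendsto (fun σ : ℝ => ∫ ε, F (z + σ • ε) * π ε)
        (nhdsWithin 0 (Set.Ioi 0)) (nhds (∑ i, α i * d i)) := by
    intro d F hF
    refine (tendsto_finsetSum Finset.univ fun i _ => (hα i).mul_const (d i)).congr' ?_
    filter_upwards [self_mem_nhdsWithin] with σ hσ
    exact (smoothed_eq_sum n k U hopen hdisj hnull d F hF z π hπ σ hσ).symm
  refine ⟨?_, key c L hconst⟩
  have h := key (fun _ => 1) (fun _ => 1) (fun _ _ _ => rfl)
  simp only [one_mul, mul_one, hπ_int] at h
  exact tendsto_nhds_unique h tendsto_const_nhds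
end
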